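/- arXiv:2204.07345 — 2 statements merged into one kernel-verified Lean document; each statement's English description precedes it below -/
import Mathlib

section
/- Let n = 2^r p, where p is an odd prime and r ≥ 2. If S is a U(n)-extremal sequence for the Gao constant, then S has at least one and at most two odd terms (terms whose image under the natural map Z_n → Z_2 is 1). -/
open Classical in
/-- The number of terms of the sequence `S` satisfying the predicate `P`. -/
noncomputable def pcount {α : Type*} (P : α → Prop) (S : List α) : ℕ :=
  S.countP fun x => decide (P x)

/-- `S` is an `A`-weighted zero-sum sequence in `ZMod n`: there are weights
`a i ∈ A` with `∑ a i * x i = 0`. -/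
def IsWZSum {n : ℕ} (A : Set (ZMod n)) (S : List (ZMod n)) : Prop :=
  ∃ w : List (ZMod n), w.length = S.length ∧ (∀ a ∈ w, a ∈ A) ∧
    (List.zipWith (· * ·) w S).sum = 0

/-- `S` has an `A`-weighted zero-sum subsequence of length `t ≥ 1`. -/
def HasWZSS {n : ℕ} (A : Set (ZMod n)) (S : List (ZMod n)) (t : ℕ) : Prop :=
  0 < t ∧ ∃ T : List (ZMod n), T.Sublist S ∧ T.length = t ∧ IsWZSum A T

/-- `S` has a nonempty `A`-weighted zero-sum subsequence. -/
def HasWZS {n : ℕ} (A : Set (ZMod n)) (S : List (ZMod n)) : Prop :=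
  ∃ T : List (ZMod n), T.Sublist S ∧ T ≠ [] ∧ IsWZSum A T

/-- The `A`-weighted Davenport constant `D_A(n)`: the least `k > 0` such that every
sequence of length `k` in `ZMod n` has a nonempty `A`-weighted zero-sum subsequence. -/
noncomputable def DavC (n : ℕ) (A : Set (ZMod n)) : ℕ :=
  sInf {k | 0 < k ∧ ∀ S : List (ZMod n), S.length = k → HasWZS A S}

/-- The `A`-weighted Gao constant `E_A(n)`: the least `k > 0` such that every
sequence of length `k` in `ZMod n` has an `A`-weighted zero-sum subsequence of length `n`. -/
noncomputable def GaoC (n : ℕ) (A : Set (ZMod n)) : ℕ :=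
  sInf {k | 0 < k ∧ ∀ S : List (ZMod n), S.length = k → HasWZSS A S n}

/-- The set of units of `ZMod n`. -/
def U (n : ℕ) : Set (ZMod n) := {x | IsUnit x}

/-- An `A`-extremal sequence for the Gao constant: a sequence of length `E_A(n) - 1`
with no `A`-weighted zero-sum subsequence of length `n`. -/
def IsGaoExtremal (n : ℕ) (A : Set (ZMod n)) (S : List (ZMod n)) : Prop :=
  S.length = GaoC n A - 1 ∧ ¬ HasWZSS A S n

/-- `S` and `T` are `A`-equivalent: there are a unit `c`, weights `a i ∈ A` and a
permutation matching the multiset of terms `c * y j` with the multiset `a i * x i`. -/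
def AEquiv {n : ℕ} (A : Set (ZMod n)) (S T : List (ZMod n)) : Prop :=
  ∃ c : ZMod n, IsUnit c ∧ ∃ w : List (ZMod n), w.length = S.length ∧
    (∀ a ∈ w, a ∈ A) ∧ (T.map fun y => c * y).Perm (List.zipWith (· * ·) w S)

/-- The set of sums `∑ a i * x i` with weights `a i ∈ A`, where `x i` are the terms of a list. -/
def weightedSums {R : Type*} [CommRing R] (A : Set R) : List R → Set R
  | [] => {0}
  | x :: l => {t | ∃ a ∈ A, ∃ s ∈ weightedSums A l, t = a * x + s}

theorem mem_weightedSums_iff {R : Type*} [CommRing R] (A : Set R) (l : List R) (t : R) :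
    t ∈ weightedSums A l ↔ ∃ w : List R, w.length = l.length ∧ (∀ a ∈ w, a ∈ A) ∧
      (List.zipWith (· * ·) w l).sum = t := by
  induction l generalizing t with
  | nil =>
    simp only [weightedSums, Set.mem_singleton_iff]
    constructor
    · rintro rfl
      exact ⟨[], by simp⟩
    · rintro ⟨w, -, -, h⟩
      simpa using h.symm
  | cons x l ih =>
    simp only [weightedSums, Set.mem_ofPred_eq]
    constructor
    · rintro ⟨a, ha, s, hs, rfl⟩
      obtain ⟨w, hw, hA, hsum⟩ := (ih s).1 hs
      exact ⟨a :: w, by simp [hw], by simpa using ⟨ha, hA⟩, by simp [hsum]⟩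
    · rintro ⟨w, hw, hA, hsum⟩
      cases w with
      | nil => simp at hw
      | cons a w =>
        refine ⟨a, hA a (by simp), _,
          (ih _).2 ⟨w, by simpa using hw, fun b hb => hA b (by simp [hb]), rfl⟩, ?_⟩
        simpa using hsum.symm

theorem isWZSum_iff {n : ℕ} (A : Set (ZMod n)) (l : List (ZMod n)) :
    IsWZSum A l ↔ 0 ∈ weightedSums A l :=
  (mem_weightedSums_iff A l 0).symm

theorem zero_mem_weightedSums {R : Type*} [CommRing R] (l : List R) (h : ∀ x ∈ l, x = 0) :
    0 ∈ weightedSums {x : R | IsUnit x} l := by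
  induction l with
  | nil => simp [weightedSums]
  | cons x l ih =>
    exact ⟨1, isUnit_one, 0, ih fun y hy => h y (by simp [hy]), by simp [h x (by simp)]⟩

theorem mul_mem_weightedSums {R : Type*} [CommRing R] (A : Set R) (c : R) (l : List R) (t : R)
    (h : t ∈ weightedSums A l) : c * t ∈ weightedSums A (l.map (c * ·)) := by
  induction l generalizing t with
  | nil => simp_all [weightedSums]
  | cons x l ih =>
    obtain ⟨a, ha, s, hs, rfl⟩ := h
    exact ⟨a, ha, c * s, ih s hs, by ring⟩

/-- Weighted sums in two quotients lift simultaneously when pairs of units do. -/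
theorem exists_mem_weightedSums_of_map {R R₁ R₂ : Type*} [CommRing R] [CommRing R₁] [CommRing R₂]
    (f : R →+* R₁) (g : R →+* R₂)
    (hfg : ∀ a b, IsUnit a → IsUnit b → ∃ c, IsUnit c ∧ f c = a ∧ g c = b)
    (l : List R) (s : R₁) (t : R₂) (hs : s ∈ weightedSums {x | IsUnit x} (l.map f))
    (ht : t ∈ weightedSums {x | IsUnit x} (l.map g)) :
    ∃ u ∈ weightedSums {x | IsUnit x} l, f u = s ∧ g u = t := by
  induction l generalizing s t with
  | nil => simp_all [weightedSums]
  | cons x l ih =>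
    obtain ⟨a, ha, s', hs', rfl⟩ := hs
    obtain ⟨b, hb, t', ht', rfl⟩ := ht
    obtain ⟨c, hc, rfl, rfl⟩ := hfg a b ha hb
    obtain ⟨u, hu, rfl, rfl⟩ := ih s' t' hs' ht'
    exact ⟨c * x + u, ⟨c, hc, u, hu, rfl⟩, by simp, by simp⟩

/-- In a field with more than two elements, a list with at least one nonzero term has every
nonzero element as a weighted sum, and with at least two nonzero terms every element. -/
theorem weightedSums_field {F : Type*} [Field F] [DecidableEq F]
    (hF : ∀ c : F, ∃ a : F, a ≠ 0 ∧ a ≠ c) (l : List F) :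
    (1 ≤ l.countP (· ≠ 0) → ∀ t ≠ 0, t ∈ weightedSums {x | IsUnit x} l) ∧
      (2 ≤ l.countP (· ≠ 0) → ∀ t, t ∈ weightedSums {x | IsUnit x} l) := by
  induction l with
  | nil => simp
  | cons x l ih =>
    by_cases hx : x = 0
    · subst hx
      simp only [ne_eq, not_true_eq_false, decide_false, Bool.false_eq_true, not_false_eq_true,
        List.countP_cons_of_neg] at ih ⊢
      exact ⟨fun h t ht => ⟨1, isUnit_one, t, ih.1 h t ht, by simp⟩,
        fun h t => ⟨1, isUnit_one, t, ih.2 h t, by simp⟩⟩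
    · rw [List.countP_cons_of_pos (by simpa using hx)]
      have main : 1 ≤ l.countP (· ≠ 0) → ∀ t, t ∈ weightedSums {x | IsUnit x} (x :: l) := by
        intro h t
        obtain ⟨a, ha, hat⟩ := hF (t / x)
        refine ⟨a, ha.isUnit, t - a * x, ih.1 h _ fun h0 => hat ?_, by ring⟩
        rw [eq_div_iff hx]
        exact (sub_eq_zero.1 h0).symm
      refine ⟨fun _ t ht => ?_, fun h t => main (by omega) t⟩
      rcases Nat.eq_zero_or_pos (l.countP (· ≠ 0)) with h0 | h0
      · refine ⟨t / x, (div_ne_zero ht hx).isUnit, 0, zero_mem_weightedSums l ?_, ?_⟩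
        · simpa [List.countP_eq_zero] using h0
        · field_simp
          simp
      · exact main h0 t

theorem zero_mem_weightedSums_field {F : Type*} [Field F] [DecidableEq F]
    (hF : ∀ c : F, ∃ a : F, a ≠ 0 ∧ a ≠ c) (l : List F) (h : l.countP (· ≠ 0) ≠ 1) :
    0 ∈ weightedSums {x | IsUnit x} l := by
  rcases Nat.eq_zero_or_pos (l.countP (· ≠ 0)) with h0 | h0
  · exact zero_mem_weightedSums l (by simpa [List.countP_eq_zero] using h0)
  · exact (weightedSums_field hF l).2 (by omega) 0

theorem ZMod.two_eq_zero_or_one (x : ZMod 2) : x = 0 ∨ x = 1 := by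
  revert x
  decide

/-- In a ring with a local homomorphism to `ZMod 2`, the weighted sums of a list containing a
unit are all the elements of the right parity. -/
theorem weightedSums_parity {R : Type*} [CommRing R] (π : R →+* ZMod 2)
    (hπ : ∀ x, π x = 1 → IsUnit x) (l : List R) :
    (∃ t ∈ weightedSums {x | IsUnit x} l, π t = (l.countP fun x => π x = 1 : ℕ)) ∧
    (1 ≤ l.countP (fun x => π x = 1) → ∀ t, π t = (l.countP fun x => π x = 1 : ℕ) →
      t ∈ weightedSums {x | IsUnit x} l) := by
  induction l with
  | nil => simp [weightedSums]
  | cons x l ih =>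
    obtain ⟨⟨t₀, ht₀, hpt₀⟩, ih⟩ := ih
    rcases ZMod.two_eq_zero_or_one (π x) with hx | hx
    · rw [List.countP_cons_of_neg (by simp [hx])]
      refine ⟨⟨x + t₀, ⟨1, isUnit_one, t₀, ht₀, by simp⟩, by simp [hx, hpt₀]⟩, fun h t ht => ?_⟩
      exact ⟨1, isUnit_one, t - x, ih h _ (by simp [hx, ht]), by ring⟩
    · rw [List.countP_cons_of_pos (by simp [hx])]
      refine ⟨⟨x + t₀, ⟨1, isUnit_one, t₀, ht₀, by simp⟩,
        by simp [hx, hpt₀, add_comm]⟩, fun _ t ht => ?_⟩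
      rcases Nat.eq_zero_or_pos (l.countP fun x => π x = 1) with h0 | h0
      · obtain ⟨u, hu⟩ := hπ x hx
        refine ⟨(t - t₀) * ↑u⁻¹, ?_, t₀, ht₀, ?_⟩
        · refine IsUnit.mul (hπ _ ?_) (Units.isUnit _)
          rw [map_sub, ht, hpt₀]
          simp
        · rw [← hu, mul_assoc, Units.inv_mul]
          ring
      · exact ⟨1, isUnit_one, t - x, ih h0 _ (by simp [hx, ht]), by ring⟩

/-- From a list one can extract a sublist with prescribed class sizes. -/
theorem exists_sublist_countP_eq {α ι : Type*} [DecidableEq ι] (c : α → ι) (S : List α)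
    (g : ι → ℕ) (hg : ∀ i, g i ≤ S.countP (fun x => c x = i)) :
    ∃ T : List α, T.Sublist S ∧ ∀ i, T.countP (fun x => c x = i) = g i := by
  induction S generalizing g with
  | nil => exact ⟨[], List.Sublist.refl _, fun i => by simpa [eq_comm] using hg i⟩
  | cons x S ih =>
    by_cases h : g (c x) ≤ S.countP (fun y => c y = c x)
    · obtain ⟨T, hT, hc⟩ := ih g fun i => by
        by_cases hi : c x = i
        · exact hi ▸ h
        · simpa [List.countP_cons, hi] using hg i
      exact ⟨T, hT.cons x, hc⟩
    · obtain ⟨T, hT, hc⟩ := ih (Function.update g (c x) (g (c x) - 1)) fun i => by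
        have := hg i
        by_cases hi : c x = i
        · subst hi
          simp only [List.countP_cons, decide_true, if_true] at this
          simp only [Function.update_self]
          omega
        · simpa [List.countP_cons, hi, Function.update_of_ne (Ne.symm hi)] using this
      refine ⟨x :: T, hT.cons_cons x, fun i => ?_⟩
      rw [List.countP_cons, hc]
      by_cases hi : c x = i
      · subst hi
        simp
        omega
      · simp [hi, Function.update_of_ne (Ne.symm hi)]

theorem countP_fst_pair {α : Type*} (P q : α → Bool) (S : List α) :
    S.countP P = S.countP (fun x => (P x, q x) = (true, true)) +
      S.countP (fun x => (P x, q x) = (true, false)) := by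
  induction S with
  | nil => simp
  | cons x S ih =>
    simp only [List.countP_cons, ih]
    cases P x <;> cases q x <;> simp <;> omega

theorem countP_snd_pair {α : Type*} (P q : α → Bool) (S : List α) :
    S.countP q = S.countP (fun x => (P x, q x) = (true, true)) +
      S.countP (fun x => (P x, q x) = (false, true)) := by
  induction S with
  | nil => simp
  | cons x S ih =>
    simp only [List.countP_cons, ih]
    cases P x <;> cases q x <;> simp <;> omega

theorem length_eq_pair {α : Type*} (P q : α → Bool) (S : List α) :
    S.length = S.countP P + S.countP (fun x => (P x, q x) = (false, true)) +
      S.countP (fun x => (P x, q x) = (false, false)) := by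
  induction S with
  | nil => simp
  | cons x S ih =>
    simp only [List.countP_cons, ih, List.length_cons]
    cases P x <;> cases q x <;> simp <;> omega

/-- Sublists with prescribed numbers of terms in the four classes given by two predicates. -/
theorem exists_sublist_of_pair {α : Type*} (P q : α → Bool) (S : List α) (a b c e : ℕ)
    (ha : a ≤ S.countP (fun x => (P x, q x) = (true, true)))
    (hb : b ≤ S.countP (fun x => (P x, q x) = (true, false)))
    (hc : c ≤ S.countP (fun x => (P x, q x) = (false, true)))
    (he : e ≤ S.countP (fun x => (P x, q x) = (false, false))) :
    ∃ T : List α, T.Sublist S ∧ T.length = a + b + c + e ∧ T.countP P = a + b ∧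
      T.countP q = a + c := by
  obtain ⟨T, hT, h⟩ := exists_sublist_countP_eq (fun x => (P x, q x)) S
    (fun i => match i with
      | (true, true) => a
      | (true, false) => b
      | (false, true) => c
      | (false, false) => e)
    (by rintro ⟨_ | _, _ | _⟩ <;> assumption)
  have h1 := h (true, true)
  have h2 := h (true, false)
  have h3 := h (false, true)
  have h4 := h (false, false)
  simp only at h1 h2 h3 h4
  have h5 := countP_fst_pair P q T
  refine ⟨T, hT, ?_, ?_, ?_⟩
  · rw [length_eq_pair P q T, h5, h1, h2, h3, h4]
  · rw [h5, h1, h2]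
  · rw [countP_snd_pair P q T, h1, h3]

/-- Sublists with prescribed numbers of terms satisfying and not satisfying a predicate. -/
theorem exists_sublist_of_countP {α : Type*} (P : α → Bool) (S : List α) (b e : ℕ)
    (hb : b ≤ S.countP P) (he : S.countP P + e ≤ S.length) :
    ∃ T : List α, T.Sublist S ∧ T.length = b + e ∧ T.countP P = b := by
  have h1 := length_eq_pair P (fun _ => false) S
  have h2 := countP_fst_pair P (fun _ => false) S
  have h3 : S.countP (fun x => (P x, false) = (true, true)) = 0 := by simp
  have h4 : S.countP (fun x => (P x, false) = (false, true)) = 0 := by simp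
  obtain ⟨T, hT, hTl, hTP, -⟩ := exists_sublist_of_pair P (fun _ => false) S 0 b 0 e
    (by omega) (by omega) (by omega) (by omega)
  exact ⟨T, hT, by omega, by omega⟩

theorem exists_class_sizes (a b c e L : ℕ) (hL : Even L) (hL4 : 4 ≤ L)
    (hlen : L + 2 ≤ a + b + c + e) (hab : 2 ≤ a + b) (hne : ¬ (a = 1 ∧ b = 1 ∧ c = 0)) :
    ∃ a' b' c' e', a' ≤ a ∧ b' ≤ b ∧ c' ≤ c ∧ e' ≤ e ∧ a' + b' + c' + e' = L ∧
      Even (a' + b') ∧ 0 < a' + b' ∧ a' + c' ≠ 1 := by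
  obtain ⟨m, rfl⟩ := hL
  have key : ∀ j, j ≤ m → 0 < j → 2 * j ≤ a + b → 2 * m ≤ 2 * j + c + e →
      (min a (2 * j) + min c (2 * m - 2 * j) ≠ 1 ∨
        (2 * j - b) + (2 * m - 2 * j - e) ≠ 1) →
      ∃ a' b' c' e', a' ≤ a ∧ b' ≤ b ∧ c' ≤ c ∧ e' ≤ e ∧ a' + b' + c' + e' = m + m ∧
        Even (a' + b') ∧ 0 < a' + b' ∧ a' + c' ≠ 1 := by
    intro j h1 h2 h3 h4 h5
    rcases h5 with h5 | h5
    · exact ⟨min a (2 * j), 2 * j - min a (2 * j), min c (2 * m - 2 * j),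
        2 * m - 2 * j - min c (2 * m - 2 * j), by omega, by omega, by omega, by omega, by omega,
        ⟨j, by omega⟩, by omega, h5⟩
    · exact ⟨2 * j - b, 2 * j - (2 * j - b), 2 * m - 2 * j - e,
        2 * m - 2 * j - (2 * m - 2 * j - e), by omega, by omega, by omega, by omega, by omega,
        ⟨j, by omega⟩, by omega, h5⟩
  by_contra hcon
  have hkey : ∀ j, ¬ (j ≤ m ∧ 0 < j ∧ 2 * j ≤ a + b ∧ 2 * m ≤ 2 * j + c + e ∧
      (min a (2 * j) + min c (2 * m - 2 * j) ≠ 1 ∨ (2 * j - b) + (2 * m - 2 * j - e) ≠ 1)) :=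
    fun j ⟨h1, h2, h3, h4, h5⟩ => hcon (key j h1 h2 h3 h4 h5)
  have hmax := hkey (min m ((a + b) / 2))
  have hmin := hkey (max 1 ((2 * m - c - e + 1) / 2))
  omega

/-- The combinatorial form of being a weighted zero-sum sequence: `P i` singles out the terms not
divisible by `2 ^ (i + 1)`, and `q` the terms not divisible by `p`. -/
def IsBalanced {α : Type*} (P : ℕ → α → Bool) (q : α → Bool) (r : ℕ) (T : List α) : Prop :=
  T.countP q ≠ 1 ∧ ∃ v ≤ r, (∀ i < v, ∀ x ∈ T, P i x = false) ∧
    (v = r ∨ Even (T.countP (P v)) ∧ 0 < T.countP (P v))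

theorem length_filter_not {α : Type*} (P : α → Bool) (S : List α) :
    S.length = S.countP P + (S.filter fun x => !P x).length := by
  rw [List.length_eq_countP_add_countP P, List.countP_eq_length_filter (p := fun a => ¬ P a)]
  simp

section Balanced

variable {α : Type*} (P : ℕ → α → Bool) (q : α → Bool) (r L : ℕ)

theorem forall_filter_not (S : List α) (v : ℕ) (hS : ∀ i < v, ∀ x ∈ S, P i x = false) :
    ∀ i < v + 1, ∀ x ∈ S.filter (fun x => !P v x), P i x = false := by
  intro i hi x hx
  rw [List.mem_filter] at hx
  rcases Nat.lt_succ_iff_lt_or_eq.1 hi with h | rfl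
  · exact hS i h x hx.1
  · simpa using hx.2

theorem exists_isBalanced_of_two_le (S : List α) (v : ℕ) (hv : v < r)
    (hS : ∀ i < v, ∀ x ∈ S, P i x = false) (hL : Even L) (hL4 : 4 ≤ L)
    (hlen : L + 2 ≤ S.length) (hodd : 2 ≤ S.countP (P v))
    (hne : ¬ (S.countP (fun x => (P v x, q x) = (true, true)) = 1 ∧
      S.countP (fun x => (P v x, q x) = (true, false)) = 1 ∧
      S.countP (fun x => (P v x, q x) = (false, true)) = 0)) :
    ∃ T : List α, T.Sublist S ∧ T.length = L ∧ IsBalanced P q r T := by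
  have h1 := length_eq_pair (P v) q S
  have h2 := countP_fst_pair (P v) q S
  obtain ⟨a, b, c, e, ha, hb, hc, he, hsum, heven, hpos, h3⟩ :=
    exists_class_sizes _ _ _ (S.countP (fun x => (P v x, q x) = (false, false))) L hL hL4
      (by omega) (by omega) hne
  obtain ⟨T, hT, hTl, hTP, hTq⟩ := exists_sublist_of_pair (P v) q S a b c e ha hb hc he
  exact ⟨T, hT, by omega, by omega, v, hv.le, fun i hi x hx => hS i hi x (hT.subset hx),
    Or.inr (by rw [hTP]; exact ⟨heven, hpos⟩)⟩

theorem exists_isBalanced_of_forall_not (d : ℕ) (S : List α) (v : ℕ) (hv : v + d = r)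
    (hS : ∀ i < v, ∀ x ∈ S, P i x = false) (hq : ∀ x ∈ S, q x = false) (hL : Even L)
    (hL4 : 4 ≤ L) (hlen : L + d ≤ S.length) :
    ∃ T : List α, T.Sublist S ∧ T.length = L ∧ IsBalanced P q r T := by
  have hcount : ∀ T : List α, T.Sublist S → T.countP q ≠ 1 := by
    intro T hT
    rw [List.countP_eq_zero.2 fun x hx => by simp [hq x (hT.subset hx)]]
    simp
  induction d generalizing S v with
  | zero =>
    refine ⟨S.take L, List.take_sublist _ _, by simpa using hlen,
      hcount _ (List.take_sublist _ _), v, by omega,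
      fun i hi x hx => hS i hi x (List.mem_of_mem_take hx), Or.inl (by omega)⟩
  | succ d ih =>
    by_cases hk : S.countP (P v) ≤ 1
    · have hlf := length_filter_not (P v) S
      have hsub : (S.filter fun x => !P v x).Sublist S := List.filter_sublist
      obtain ⟨T, hT, h⟩ := ih (S.filter fun x => !P v x) (v + 1) (by omega)
        (forall_filter_not P S v hS) (fun x hx => hq x (hsub.subset hx)) (by omega)
        (fun T hT => hcount T (hT.trans hsub))
      exact ⟨T, hT.trans hsub, h⟩
    · obtain ⟨m, rfl⟩ := hL
      obtain ⟨T, hT, hTl, hTP⟩ := exists_sublist_of_countP (P v) S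
        (2 * min m (S.countP (P v) / 2)) (2 * m - 2 * min m (S.countP (P v) / 2))
        (by omega) (by have := List.countP_le_length (p := P v) (l := S); omega)
      refine ⟨T, hT, by omega, hcount T hT, v, by omega,
        fun i hi x hx => hS i hi x (hT.subset hx), Or.inr ⟨?_, by omega⟩⟩
      rw [hTP]
      simp

theorem exists_isBalanced (d : ℕ) (S : List α) (v : ℕ) (hv : v + d = r)
    (hS : ∀ i < v, ∀ x ∈ S, P i x = false) (hL : Even L) (hL4 : 4 ≤ L)
    (hlen : L + d + 1 ≤ S.length) :
    ∃ T : List α, T.Sublist S ∧ T.length = L ∧ IsBalanced P q r T := by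
  induction d generalizing S v with
  | zero =>
    have hle := List.countP_le_length (p := q) (l := S)
    obtain ⟨b, e, hb, he, hbe, hb1⟩ : ∃ b e, b ≤ S.countP q ∧ S.countP q + e ≤ S.length ∧
        b + e = L ∧ b ≠ 1 := by
      by_cases h : S.countP q ≤ 1
      · exact ⟨0, L, by omega, by omega, by omega, by omega⟩
      · exact ⟨min L (S.countP q), L - min L (S.countP q), by omega, by omega, by omega, by omega⟩
    obtain ⟨T, hT, hTl, hTP⟩ := exists_sublist_of_countP q S b e hb he
    exact ⟨T, hT, by omega, by omega, v, by omega,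
      fun i hi x hx => hS i hi x (hT.subset hx), Or.inl (by omega)⟩
  | succ d ih =>
    have hlf := length_filter_not (P v) S
    have hsub : (S.filter fun x => !P v x).Sublist S := List.filter_sublist
    by_cases hk : S.countP (P v) ≤ 1
    · obtain ⟨T, hT, h⟩ := ih (S.filter fun x => !P v x) (v + 1) (by omega)
        (forall_filter_not P S v hS) (by omega)
      exact ⟨T, hT.trans hsub, h⟩
    · by_cases hne : S.countP (fun x => (P v x, q x) = (true, true)) = 1 ∧
        S.countP (fun x => (P v x, q x) = (true, false)) = 1 ∧
        S.countP (fun x => (P v x, q x) = (false, true)) = 0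
      · have h2 := countP_fst_pair (P v) q S
        obtain ⟨T, hT, h⟩ := exists_isBalanced_of_forall_not P q r L d
          (S.filter fun x => !P v x) (v + 1) (by omega) (forall_filter_not P S v hS)
          (fun x hx => by
            rw [List.mem_filter] at hx
            have := List.countP_eq_zero.1 hne.2.2 x hx.1
            simp_all) hL hL4 (by omega)
        exact ⟨T, hT.trans hsub, h⟩
      · exact exists_isBalanced_of_two_le P q r L S v (by omega) hS hL hL4 (by omega) (by omega) hne

end Balanced

theorem ZMod.castHom_eq_natCast_val {n m : ℕ} [NeZero n] (h : m ∣ n) (x : ZMod n) :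
    ZMod.castHom h (ZMod m) x = (x.val : ZMod m) := by
  rw [ZMod.castHom_apply, ZMod.natCast_val]

theorem ZMod.natCast_two_eq_one_iff (k : ℕ) : (k : ZMod 2) = 1 ↔ ¬ 2 ∣ k := by
  rw [ZMod.natCast_eq_one_iff_odd, ← even_iff_two_dvd, Nat.not_even_iff_odd]

theorem ZMod.isUnit_of_castHom_two_eq_one {r : ℕ} (hr : r ≠ 0) (x : ZMod (2 ^ r))
    (hx : ZMod.castHom (dvd_pow_self 2 hr) (ZMod 2) x = 1) : IsUnit x := by
  rw [ZMod.castHom_eq_natCast_val, ZMod.natCast_two_eq_one_iff] at hx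
  rw [← ZMod.natCast_zmod_val x, ZMod.isUnit_iff_coprime]
  exact ((Nat.prime_two.coprime_iff_not_dvd.2 hx).symm).pow_right r

theorem ZMod.exists_isUnit_castHom_eq {m k : ℕ} (h : m.Coprime k) (a : ZMod m) (b : ZMod k)
    (ha : IsUnit a) (hb : IsUnit b) :
    ∃ c : ZMod (m * k), IsUnit c ∧ ZMod.castHom (dvd_mul_right m k) (ZMod m) c = a ∧
      ZMod.castHom (dvd_mul_left k m) (ZMod k) c = b := by
  refine ⟨(ZMod.chineseRemainder h).symm (a, b),
    (Prod.isUnit_iff.2 ⟨ha, hb⟩).map (ZMod.chineseRemainder h).symm, ?_, ?_⟩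
  · have : (ZMod.castHom (dvd_mul_right m k) (ZMod m)) =
        (RingHom.fst _ _).comp (ZMod.chineseRemainder h).toRingHom := RingHom.ext_zmod _ _
    rw [this]
    simp
  · have : (ZMod.castHom (dvd_mul_left k m) (ZMod k)) =
        (RingHom.snd _ _).comp (ZMod.chineseRemainder h).toRingHom := RingHom.ext_zmod _ _
    rw [this]
    simp

theorem isWZSum_of_isBalanced {r p : ℕ} (hr : r ≠ 0) (hp : p.Prime) (hpodd : p ≠ 2)
    (T : List (ZMod (2 ^ r * p)))
    (hT : IsBalanced (fun i x => decide (¬ 2 ^ (i + 1) ∣ x.val)) (fun x => decide (¬ p ∣ x.val))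
      r T) :
    IsWZSum (U (2 ^ r * p)) T := by
  have : Fact p.Prime := ⟨hp⟩
  have : NeZero (2 ^ r * p) := ⟨mul_ne_zero (by positivity) hp.ne_zero⟩
  have hcop : (2 ^ r).Coprime p :=
    ((Nat.coprime_primes Nat.prime_two hp).2 (Ne.symm hpodd)).pow_left r
  obtain ⟨hq, v, hvr, hdvd, hv⟩ := hT
  have hdvd' : ∀ x ∈ T, 2 ^ v ∣ x.val := by
    intro x hx
    rcases v with _ | v
    · simp
    · simpa using hdvd v (by omega) x hx
  have hzero_p : (0 : ZMod p) ∈ weightedSums {x | IsUnit x}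
      (T.map (ZMod.castHom (dvd_mul_left p (2 ^ r)) (ZMod p))) := by
    refine zero_mem_weightedSums_field (fun c => ?_) _ ?_
    · by_contra! hc
      have h1 := hc 1 one_ne_zero
      have h2 := hc (-1) (neg_ne_zero.2 one_ne_zero)
      have : Fact (2 < p) := ⟨lt_of_le_of_ne hp.two_le (Ne.symm hpodd)⟩
      exact ZMod.neg_one_ne_one (h2.trans h1.symm)
    · rw [List.countP_map]
      refine ne_of_eq_of_ne (List.countP_congr fun x _ => ?_) hq
      simp only [Function.comp_apply, ZMod.castHom_eq_natCast_val, ne_eq,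
        ZMod.natCast_eq_zero_iff]
  have hzero_two : (0 : ZMod (2 ^ r)) ∈ weightedSums {x | IsUnit x}
      (T.map (ZMod.castHom (dvd_mul_right (2 ^ r) p) (ZMod (2 ^ r)))) := by
    rcases hv with rfl | ⟨heven, hpos⟩
    · refine zero_mem_weightedSums _ fun y hy => ?_
      obtain ⟨x, hx, rfl⟩ := List.mem_map.1 hy
      rw [ZMod.castHom_eq_natCast_val, ZMod.natCast_eq_zero_iff]
      exact hdvd' x hx
    · have hmap : T.map (ZMod.castHom (dvd_mul_right (2 ^ r) p) (ZMod (2 ^ r))) =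
          (T.map fun x => ((x.val / 2 ^ v : ℕ) : ZMod (2 ^ r))).map (2 ^ v * ·) := by
        rw [List.map_map]
        refine List.map_congr_left fun x hx => ?_
        rw [ZMod.castHom_eq_natCast_val]
        nth_rewrite 1 [← Nat.mul_div_cancel' (hdvd' x hx)]
        simp
      have hcount : (T.map fun x => ((x.val / 2 ^ v : ℕ) : ZMod (2 ^ r))).countP
          (fun x => ZMod.castHom (dvd_pow_self 2 hr) (ZMod 2) x = 1) =
          T.countP (fun x => decide (¬ 2 ^ (v + 1) ∣ x.val)) := by
        rw [List.countP_map]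
        refine List.countP_congr fun x hx => ?_
        simp only [Function.comp_apply, map_natCast, decide_eq_true_eq,
          ZMod.natCast_two_eq_one_iff]
        rw [Nat.dvd_div_iff_mul_dvd (hdvd' x hx), pow_succ]
      rw [hmap]
      refine mul_zero (2 ^ v : ZMod (2 ^ r)) ▸ mul_mem_weightedSums _ _ _ _
        ((weightedSums_parity _ (ZMod.isUnit_of_castHom_two_eq_one hr) _).2
          (by rw [hcount]; exact hpos) 0 ?_)
      rw [hcount, map_zero]
      exact ((ZMod.natCast_eq_zero_iff_even).2 heven).symm
  obtain ⟨u, hu, hu2, hup⟩ := exists_mem_weightedSums_of_map _ _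
    (ZMod.exists_isUnit_castHom_eq hcop) T 0 0 hzero_two hzero_p
  rw [isWZSum_iff]
  have hu0 : u = 0 := by
    rw [ZMod.castHom_eq_natCast_val, ZMod.natCast_eq_zero_iff] at hu2 hup
    rw [← ZMod.natCast_zmod_val u, ZMod.natCast_eq_zero_iff]
    exact hcop.mul_dvd_of_dvd_of_dvd hu2 hup
  exact hu0 ▸ hu

theorem not_two_pow_succ_dvd {r p i : ℕ} (hi : i < r) :
    ¬ (2 ^ (i + 1) : ZMod (2 ^ r * p)) ∣ 2 ^ i := by
  rintro ⟨c, hc⟩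
  have h := congrArg (ZMod.castHom (n := 2 ^ r * p) (m := 2 ^ (i + 1))
    (dvd_mul_of_dvd_left (pow_dvd_pow 2 hi) p) (ZMod (2 ^ (i + 1)))) hc
  have h2 : (2 ^ (i + 1) : ZMod (2 ^ (i + 1))) = 0 := by
    exact_mod_cast ZMod.natCast_self (2 ^ (i + 1))
  rw [map_mul, map_pow, map_pow, map_ofNat, h2, zero_mul] at h
  have h3 : ((2 ^ i : ℕ) : ZMod (2 ^ (i + 1))) = 0 := by exact_mod_cast h
  rw [ZMod.natCast_eq_zero_iff, Nat.pow_dvd_pow_iff_le_right (by norm_num)] at h3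
  omega

theorem two_pow_ne_zero {r p : ℕ} (hp : p.Prime) : (2 ^ r : ZMod (2 ^ r * p)) ≠ 0 := by
  intro h
  have h3 : ((2 ^ r : ℕ) : ZMod (2 ^ r * p)) = 0 := by exact_mod_cast h
  rw [ZMod.natCast_eq_zero_iff] at h3
  have := Nat.le_of_dvd (by positivity) h3
  have : 0 < 2 ^ r := by positivity
  nlinarith [hp.two_le]

/-- A nonempty subsequence of `2 ^ i, …, 2 ^ r` is not a weighted zero-sum sequence. -/
theorem weightedSums_two_pow {r p : ℕ} (hp : p.Prime) (k i : ℕ) (hik : i + k = r + 1)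
    (T : List (ZMod (2 ^ r * p)))
    (hT : T.Sublist ((List.range' i k).map fun j => (2 ^ j : ZMod (2 ^ r * p))))
    (s : ZMod (2 ^ r * p)) (hs : s ∈ weightedSums (U (2 ^ r * p)) T) :
    2 ^ i ∣ s ∧ (T ≠ [] → s ≠ 0) := by
  induction k generalizing i T s with
  | zero =>
    obtain rfl : T = [] := by simpa using hT
    obtain rfl : s = 0 := hs
    simp
  | succ k ih =>
    rw [List.range'_succ, List.map_cons] at hT
    cases hT with
    | cons _ hT =>
      obtain ⟨h1, h2⟩ := ih (i + 1) (by omega) T hT s hs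
      exact ⟨(pow_dvd_pow 2 (Nat.le_succ i)).trans h1, h2⟩
    | cons_cons _ hT =>
      obtain ⟨a, ha, s', hs', rfl⟩ := hs
      obtain ⟨h1, -⟩ := ih (i + 1) (by omega) _ hT s' hs'
      refine ⟨dvd_add (dvd_mul_left _ _) ((pow_dvd_pow 2 (Nat.le_succ i)).trans h1),
        fun _ h0 => ?_⟩
      have ha : IsUnit a := ha
      rcases Nat.lt_or_ge i r with hi | hi
      · refine not_two_pow_succ_dvd (p := p) hi ?_
        have h3 : (2 ^ (i + 1) : ZMod (2 ^ r * p)) ∣ a * 2 ^ i :=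
          (dvd_add_left h1).1 (h0 ▸ dvd_zero _)
        exact (ha.dvd_mul_left).1 h3
      · obtain rfl : k = 0 := by omega
        obtain rfl : i = r := by omega
        simp only [List.range'_zero, List.map_nil, List.sublist_nil] at hT
        subst hT
        obtain rfl : s' = 0 := hs'
        rw [add_zero, ha.mul_right_eq_zero] at h0
        exact two_pow_ne_zero hp h0

theorem weightedSums_zero_append {R : Type*} [CommRing R] (A : Set R) (l₁ l₂ : List R)
    (h : ∀ x ∈ l₁, x = 0) (t : R) (ht : t ∈ weightedSums A (l₁ ++ l₂)) :
    t ∈ weightedSums A l₂ := by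
  induction l₁ generalizing t with
  | nil => exact ht
  | cons x l ih =>
    obtain ⟨a, -, s, hs, rfl⟩ := ht
    rw [h x (by simp), mul_zero, zero_add]
    exact ih (fun y hy => h y (by simp [hy])) s hs

theorem not_hasWZSS_zeros_append_two_pow {r p : ℕ} (hp : p.Prime) :
    ¬ HasWZSS (U (2 ^ r * p)) (List.replicate (2 ^ r * p - 1) 0 ++
      (List.range' 0 (r + 1)).map fun j => (2 ^ j : ZMod (2 ^ r * p))) (2 ^ r * p) := by
  rintro ⟨hn, T, hT, hlen, hz⟩
  obtain ⟨T₁, T₂, rfl, h1, h2⟩ := List.sublist_append_iff.1 hT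
  rw [isWZSum_iff] at hz
  have hz2 := weightedSums_zero_append _ T₁ T₂
    (fun x hx => List.eq_of_mem_replicate (h1.subset hx)) 0 hz
  refine (weightedSums_two_pow hp (r + 1) 0 (by omega) T₂ h2 0 hz2).2 ?_ rfl
  rintro rfl
  have := h1.length_le
  simp at this hlen
  omega

theorem le_gaoC {r p : ℕ} (hr : 2 ≤ r) (hp : p.Prime) (hpodd : p ≠ 2) :
    2 ^ r * p + r + 1 ≤ GaoC (2 ^ r * p) (U (2 ^ r * p)) := by
  have hpos : 0 < 2 ^ r * p := Nat.mul_pos (by positivity) hp.pos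
  refine le_csInf ⟨2 ^ r * p + r + 1, by omega, fun S hS => ?_⟩ ?_
  · obtain ⟨T, hT, hTl, hb⟩ := exists_isBalanced
      (fun i (x : ZMod (2 ^ r * p)) => decide (¬ 2 ^ (i + 1) ∣ x.val))
      (fun x => decide (¬ p ∣ x.val)) r (2 ^ r * p) r S 0 (by omega) (by simp) ((Nat.even_pow.2 ⟨even_two, by omega⟩).mul_right p)
      ((Nat.pow_le_pow_right two_pos hr).trans (Nat.le_mul_of_pos_right _ hp.pos))
      hS.ge
    exact ⟨hpos, T, hT, hTl, isWZSum_of_isBalanced (by omega) hp hpodd T hb⟩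
  · rintro k ⟨-, hk⟩
    by_contra! hlt
    obtain ⟨h0, T, hT, h⟩ := hk ((List.replicate (2 ^ r * p - 1) 0 ++
      (List.range' 0 (r + 1)).map fun j => (2 ^ j : ZMod (2 ^ r * p))).take k) (by
        simp; omega)
    exact not_hasWZSS_zeros_append_two_pow hp ⟨h0, T, hT.trans (List.take_sublist _ _), h⟩

/-- For `n = 2 ^ r * p`, `p` an odd prime, `r ≥ 2`: a `U(n)`-extremal sequence for the
Gao constant has at least one and at most two odd terms. -/
theorem gao_extremal_odd_terms_bound (r p : ℕ) (hr : 2 ≤ r) (hp : p.Prime) (hpodd : p ≠ 2)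
    (S : List (ZMod (2 ^ r * p)))
    (hS : IsGaoExtremal (2 ^ r * p) (U (2 ^ r * p)) S) :
    1 ≤ pcount (fun x => ZMod.castHom
        (dvd_mul_of_dvd_left (dvd_pow_self 2 (by omega)) p) (ZMod 2) x = 1) S ∧
    pcount (fun x => ZMod.castHom
        (dvd_mul_of_dvd_left (dvd_pow_self 2 (by omega)) p) (ZMod 2) x = 1) S ≤ 2 := by
  have hpos : 0 < 2 ^ r * p := Nat.mul_pos (by positivity) hp.pos
  have : NeZero (2 ^ r * p) := ⟨hpos.ne'⟩
  have heven : Even (2 ^ r * p) := (Nat.even_pow.2 ⟨even_two, by omega⟩).mul_right p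
  have hfour : 4 ≤ 2 ^ r * p :=
    (Nat.pow_le_pow_right two_pos hr).trans (Nat.le_mul_of_pos_right _ hp.pos)
  have hle := le_gaoC hr hp hpodd
  obtain ⟨hlen, hno⟩ := hS
  let P : ℕ → ZMod (2 ^ r * p) → Bool := fun i x => decide (¬ 2 ^ (i + 1) ∣ x.val)
  let q : ZMod (2 ^ r * p) → Bool := fun x => decide (¬ p ∣ x.val)
  have hbal : ¬ ∃ T : List _, T.Sublist S ∧ T.length = 2 ^ r * p ∧ IsBalanced P q r T :=
    fun ⟨T, hT, hTl, hb⟩ =>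
      hno ⟨hpos, T, hT, hTl, isWZSum_of_isBalanced (by omega) hp hpodd T hb⟩
  have hcount : pcount (fun x => ZMod.castHom
      (dvd_mul_of_dvd_left (dvd_pow_self 2 (by omega)) p) (ZMod 2) x = 1) S = S.countP (P 0) := by
    refine List.countP_congr fun x _ => ?_
    simp only [P, decide_eq_true_eq, ZMod.castHom_eq_natCast_val, ZMod.natCast_two_eq_one_iff,
      zero_add, pow_one]
  rw [hcount]
  constructor
  · by_contra! h
    refine hbal (exists_isBalanced P q r _ (r - 1) S 1 (by omega) (fun i hi x hx => ?_)
      heven hfour (by omega))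
    obtain rfl : i = 0 := by omega
    simpa using List.countP_eq_zero.1 (by omega : S.countP (P 0) = 0) x hx
  · by_contra! h
    have h2 := countP_fst_pair (P 0) q S
    exact hbal (exists_isBalanced_of_two_le P q r _ S 0 (by omega) (by simp) heven hfour
      (by omega) (by omega) (by omega))
end

section
/- Let n = 2^r p, where p is an odd prime and r ≥ 2, and let S be a sequence in Z_n which has exactly two odd terms. Then S is a U(n)-extremal sequence for the Gao constant if and only if S is U(n)-equivalent to a sequence of the form (∗), i.e., to a sequence (b_1, p_1 b_2, p_1 p_2 b_3, …, p_1 ⋯ p_{k−1} b_k, n/2, …, n/2, 0, …, 0), where n = 2 p_1 ⋯ p_k is a factorization with the p_i prime, each b_i is coprime to p_i, n/2 occurs m times with m odd, and 0 occurs n − m times. -/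
section Combinatorics

open Classical

variable {α : Type*}

/-- The number of terms satisfying `P`, with classical decidability. -/
noncomputable def Multiset.cnt (P : α → Prop) (T : Multiset α) : ℕ := T.countP P

theorem Multiset.cnt_eq_card_filter (P : α → Prop) [DecidablePred P] (T : Multiset α) :
    T.cnt P = (T.filter P).card := by
  rw [← Multiset.countP_eq_card_filter, Multiset.cnt]
  congr!

theorem Multiset.cnt_pos {P : α → Prop} {T : Multiset α} : 0 < T.cnt P ↔ ∃ x ∈ T, P x :=
  Multiset.countP_pos

theorem Multiset.cnt_eq_zero {P : α → Prop} {T : Multiset α} : T.cnt P = 0 ↔ ∀ x ∈ T, ¬ P x :=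
  Multiset.countP_eq_zero

theorem Multiset.cnt_eq_card {P : α → Prop} {T : Multiset α} :
    T.cnt P = T.card ↔ ∀ x ∈ T, P x :=
  Multiset.countP_eq_card

theorem Multiset.cnt_add (P : α → Prop) (S T : Multiset α) :
    (S + T).cnt P = S.cnt P + T.cnt P :=
  Multiset.countP_add _ _ _

@[simp]
theorem Multiset.cnt_zero (P : α → Prop) : (0 : Multiset α).cnt P = 0 :=
  Multiset.countP_zero _

theorem Multiset.cnt_cons (P : α → Prop) (x : α) (T : Multiset α) :
    (x ::ₘ T).cnt P = T.cnt P + if P x then 1 else 0 :=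
  Multiset.countP_cons _ _ _

/-- `T` satisfies the parity condition for the first `r` predicates of `D`: at the first index `j`
for which not all terms satisfy `D j`, an even number of terms fails it. -/
def EvenLead (r : ℕ) (D : ℕ → α → Prop) (T : Multiset α) : Prop :=
  ∀ j < r, (∀ x ∈ T, ∀ i < j, D i x) → Even (T.cnt fun x => ¬ D j x)

theorem evenLead_of_pos {r : ℕ} {D : ℕ → α → Prop} {T : Multiset α}
    (h : Even (T.cnt fun x => ¬ D 0 x)) (hpos : 0 < T.cnt fun x => ¬ D 0 x) :
    EvenLead r D T := by
  intro j _ hj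
  rcases Nat.eq_zero_or_pos j with rfl | hj0
  · exact h
  · obtain ⟨x, hx, hDx⟩ := Multiset.cnt_pos.1 hpos
    exact absurd (hj x hx 0 hj0) hDx

theorem evenLead_succ {r : ℕ} {D : ℕ → α → Prop} {T : Multiset α} (h0 : ∀ x ∈ T, D 0 x)
    (h : EvenLead r (fun i => D (i + 1)) T) : EvenLead (r + 1) D T := by
  intro j hj hT
  cases j with
  | zero =>
    rw [Multiset.cnt_eq_zero.2 fun x hx => not_not.2 (h0 x hx)]
    exact Even.zero
  | succ j => exact h j (by omega) fun x hx i hi => hT x hx (i + 1) (by omega)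

theorem forall_lt_succ_of_shift {D : ℕ → α → Prop} {k : ℕ} {x : α} (h0 : D 0 x)
    (hk : ∀ j < k, D (j + 1) x) : ∀ j < k + 1, D j x := by
  intro j hj
  cases j with
  | zero => exact h0
  | succ j => exact hk j (by omega)

theorem exists_le_card_eq {T : Multiset α} {k : ℕ} (h : k ≤ T.card) :
    ∃ T' ≤ T, T'.card = k := by
  induction T using Quotient.inductionOn with
  | _ l =>
    exact ⟨(l.take k : List α), (List.take_sublist k l).subperm, by simpa using h⟩

/-- A submultiset can be chosen with prescribed sizes of the four classes cut out by two
predicates. -/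
theorem exists_le_counts (P Q : α → Prop) {T : Multiset α} {a b c d : ℕ}
    (ha : a ≤ T.cnt fun x => P x ∧ Q x) (hb : b ≤ T.cnt fun x => P x ∧ ¬ Q x)
    (hc : c ≤ T.cnt fun x => ¬ P x ∧ Q x) (hd : d ≤ T.cnt fun x => ¬ P x ∧ ¬ Q x) :
    ∃ T' ≤ T, T'.card = a + b + c + d ∧ T'.cnt P = a + b ∧ T'.cnt Q = a + c := by
  rw [Multiset.cnt_eq_card_filter] at ha hb hc hd
  obtain ⟨A, hA, rfl⟩ := exists_le_card_eq ha
  obtain ⟨B, hB, rfl⟩ := exists_le_card_eq hb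
  obtain ⟨C, hC, rfl⟩ := exists_le_card_eq hc
  obtain ⟨E, hE, rfl⟩ := exists_le_card_eq hd
  have hA' : ∀ x ∈ A, P x ∧ Q x := fun x hx =>
    (Multiset.mem_filter.1 (Multiset.mem_of_le hA hx)).2
  have hB' : ∀ x ∈ B, P x ∧ ¬ Q x := fun x hx =>
    (Multiset.mem_filter.1 (Multiset.mem_of_le hB hx)).2
  have hC' : ∀ x ∈ C, ¬ P x ∧ Q x := fun x hx =>
    (Multiset.mem_filter.1 (Multiset.mem_of_le hC hx)).2
  have hE' : ∀ x ∈ E, ¬ P x ∧ ¬ Q x := fun x hx =>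
    (Multiset.mem_filter.1 (Multiset.mem_of_le hE hx)).2
  refine ⟨A + B + (C + E), ?_, by simp [add_assoc], ?_, ?_⟩
  · rw [← Multiset.filter_add_not P T, ← Multiset.filter_add_not Q (T.filter P),
      ← Multiset.filter_add_not Q (T.filter fun x => ¬ P x)]
    simp only [Multiset.filter_filter]
    refine add_le_add (add_le_add ?_ ?_) (add_le_add ?_ ?_) <;>
      simpa only [and_comm (a := Q _), and_comm (a := ¬ Q _)] using ‹_›
  · simp only [Multiset.cnt_add]
    rw [Multiset.cnt_eq_card.2 fun x hx => (hA' x hx).1,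
      Multiset.cnt_eq_card.2 fun x hx => (hB' x hx).1,
      Multiset.cnt_eq_zero.2 fun x hx => (hC' x hx).1,
      Multiset.cnt_eq_zero.2 fun x hx => (hE' x hx).1]
    simp
  · simp only [Multiset.cnt_add]
    rw [Multiset.cnt_eq_card.2 fun x hx => (hA' x hx).2,
      Multiset.cnt_eq_zero.2 fun x hx => (hB' x hx).2,
      Multiset.cnt_eq_card.2 fun x hx => (hC' x hx).2,
      Multiset.cnt_eq_zero.2 fun x hx => (hE' x hx).2]
    simp

theorem cnt_and_add_cnt_and_not (P Q : α → Prop) (T : Multiset α) :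
    (T.cnt fun x => P x ∧ Q x) + (T.cnt fun x => P x ∧ ¬ Q x) = T.cnt P := by
  induction T using Multiset.induction_on with
  | empty => simp
  | cons x T ih =>
    simp only [Multiset.cnt_cons, ← ih]
    by_cases hP : P x <;> by_cases hQ : Q x <;> simp [hP, hQ] <;> omega

theorem cnt_add_cnt_not (P : α → Prop) (T : Multiset α) :
    T.cnt P + (T.cnt fun x => ¬ P x) = T.card := by
  simp only [Multiset.cnt_eq_card_filter]
  rw [← Multiset.card_add, Multiset.filter_add_not]

theorem exists_le_cnt (P : α → Prop) {T : Multiset α} {a b : ℕ}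
    (ha : a ≤ T.cnt P) (hb : b ≤ T.cnt fun x => ¬ P x) :
    ∃ T' ≤ T, T'.card = a + b ∧ T'.cnt P = a := by
  obtain ⟨T', hT', h1, h2, -⟩ := exists_le_counts P (fun _ => True) (T := T) (a := a) (b := 0)
    (c := b) (d := 0) (by simpa using ha) (Nat.zero_le _) (by simpa using hb) (Nat.zero_le _)
  exact ⟨T', hT', by omega, by omega⟩

/-- From two or more failing terms one can pick a positive even number of them, completed to `N`
terms in total. -/
theorem exists_evenLead_of_two_le {D : ℕ → α → Prop} {T : Multiset α} {N : ℕ} (r : ℕ)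
    (hN : Even N) (hN0 : 0 < N) (hT : N + 1 ≤ T.card) (ho : 2 ≤ T.cnt fun x => ¬ D 0 x) :
    ∃ T' ≤ T, T'.card = N ∧ EvenLead r D T' := by
  have hsum := cnt_add_cnt_not (fun x => ¬ D 0 x) T
  obtain ⟨t, ht, ht2, hto, htN, hte⟩ : ∃ t, Even t ∧ 2 ≤ t ∧ t ≤ (T.cnt fun x => ¬ D 0 x) ∧
      t ≤ N ∧ N - t ≤ T.cnt fun x => ¬ ¬ D 0 x := by
    generalize (T.cnt fun x => ¬ D 0 x) = o at *
    generalize (T.cnt fun x => ¬ ¬ D 0 x) = e at *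
    obtain ⟨M, rfl⟩ := hN
    rcases le_total (M + M) o with h | h
    · exact ⟨M + M, ⟨M, rfl⟩, by omega, h, le_rfl, by omega⟩
    · exact ⟨o / 2 + o / 2, ⟨_, rfl⟩, by omega, by omega, by omega, by omega⟩
  obtain ⟨T', hT', h1, h2⟩ := exists_le_cnt (fun x => ¬ D 0 x) hto hte
  exact ⟨T', hT', by omega, evenLead_of_pos (by rwa [h2]) (by omega)⟩

theorem exists_evenLead {N : ℕ} (hN : Even N) (hN0 : 0 < N) (r : ℕ) (D : ℕ → α → Prop)
    (T : Multiset α) (hT : N + r ≤ T.card) : ∃ T' ≤ T, T'.card = N ∧ EvenLead r D T' := by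
  induction r generalizing D T with
  | zero =>
    obtain ⟨T', hT', h⟩ := exists_le_card_eq (T := T) (k := N) (by omega)
    exact ⟨T', hT', h, fun j hj => absurd hj (by omega)⟩
  | succ r ih =>
    by_cases ho : 2 ≤ T.cnt fun x => ¬ D 0 x
    · exact exists_evenLead_of_two_le _ hN hN0 (by omega) ho
    · have hsum := cnt_add_cnt_not (D 0) T
      obtain ⟨T', hT', h1, h2⟩ := ih (fun i => D (i + 1)) (T.filter (D 0))
        (by rw [← Multiset.cnt_eq_card_filter]; omega)
      exact ⟨T', hT'.trans (Multiset.filter_le _ _), h1, evenLead_succ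
        (fun x hx => (Multiset.mem_filter.1 (Multiset.mem_of_le hT' hx)).2) h2⟩

theorem exists_class_sizes_s16 {N A B C E : ℕ} (hN : Even N) (hN4 : 4 ≤ N)
    (hsum : N + 2 ≤ A + B + C + E) (h1 : 2 ≤ A + B) (h2 : 2 ≤ A + C) :
    ∃ a ≤ A, ∃ b ≤ B, ∃ c ≤ C, ∃ d ≤ E,
      a + b + c + d = N ∧ Even (a + b) ∧ 0 < a + b ∧ a + c ≠ 1 := by
  have split : ∀ X Y t : ℕ, t ≤ X + Y → ∃ x ≤ X, ∃ y ≤ Y, x + y = t := fun X Y t h =>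
    ⟨min X t, min_le_left _ _, t - min X t, by omega, by omega⟩
  obtain ⟨M, rfl⟩ := hN
  rcases (by omega : 2 ≤ A ∨ A = 1 ∨ A = 0) with hA | rfl | rfl
  · obtain ⟨t, ht, hto, hte⟩ : ∃ t, t + t ≤ A - 2 + B ∧ t + 1 ≤ M ∧
        M + M - 2 - (t + t) ≤ C + E := by
      rcases le_total (M + M - 2) (A - 2 + B) with h | h
      · exact ⟨M - 1, by omega, by omega, by omega⟩
      · exact ⟨(A - 2 + B) / 2, by omega, by omega, by omega⟩
    obtain ⟨a, ha, b, hb, hab⟩ := split _ _ _ ht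
    obtain ⟨c, hc, d, hd, hcd⟩ := split _ _ _ hte
    exact ⟨a + 2, by omega, b, hb, c, hc, d, hd, by omega, ⟨t + 1, by omega⟩, by omega, by omega⟩
  · by_cases h : C - 1 + E = 0
    · exact ⟨0, by omega, M + M, by omega, 0, by omega, 0, by omega, by omega, ⟨M, by omega⟩,
        by omega, by omega⟩
    · obtain ⟨t, ht, hto, hte⟩ : ∃ t, t + t ≤ B - 1 ∧ t + 2 ≤ M ∧
          M + M - 3 - (t + t) ≤ C - 1 + E := by
        rcases le_total (M + M - 4) (B - 1) with h | h
        · exact ⟨M - 2, by omega, by omega, by omega⟩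
        · exact ⟨(B - 1) / 2, by omega, by omega, by omega⟩
      obtain ⟨c, hc, d, hd, hcd⟩ := split _ _ _ hte
      exact ⟨1, le_rfl, t + t + 1, by omega, c + 1, by omega, d, hd, by omega, ⟨t + 1, by omega⟩,
        by omega, by omega⟩
  · obtain ⟨t, ht, hto, hte⟩ : ∃ t, t + t ≤ B - 2 ∧ t + 2 ≤ M ∧
        M + M - 4 - (t + t) ≤ C - 2 + E := by
      rcases le_total (M + M - 4) (B - 2) with h | h
      · exact ⟨M - 2, by omega, by omega, by omega⟩
      · exact ⟨(B - 2) / 2, by omega, by omega, by omega⟩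
    obtain ⟨c, hc, d, hd, hcd⟩ := split _ _ _ hte
    exact ⟨0, le_rfl, t + t + 2, by omega, c + 2, by omega, d, hd, by omega, ⟨t + 1, by omega⟩,
      by omega, by omega⟩

theorem exists_evenLead_cnt_ne_one {N : ℕ} (hN : Even N) (hN4 : 4 ≤ N) (e : α → Prop) (r : ℕ)
    (D : ℕ → α → Prop) (T : Multiset α) (hT : N + r + 1 ≤ T.card) :
    ∃ T' ≤ T, T'.card = N ∧ EvenLead r D T' ∧ T'.cnt e ≠ 1 := by
  induction r generalizing D T with
  | zero =>
    have hsum := cnt_add_cnt_not e T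
    obtain ⟨a, ha, b, hb, hab, ha1⟩ : ∃ a ≤ T.cnt e, ∃ b ≤ (T.cnt fun x => ¬ e x),
        a + b = N ∧ a ≠ 1 := by
      generalize T.cnt e = A at *
      generalize (T.cnt fun x => ¬ e x) = B at *
      rcases (by omega : A ≤ 1 ∨ 2 ≤ A ∧ A ≤ N ∨ N < A) with h | h | h
      · exact ⟨0, by omega, N, by omega, by omega, by omega⟩
      · exact ⟨A, le_rfl, N - A, by omega, by omega, by omega⟩
      · exact ⟨N, by omega, 0, by omega, by omega, by omega⟩
    obtain ⟨T', hT', h1, h2⟩ := exists_le_cnt e ha hb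
    exact ⟨T', hT', by omega, fun j hj => absurd hj (by omega), by omega⟩
  | succ r ih =>
    by_cases hc : 2 ≤ T.cnt e
    · by_cases ho : 2 ≤ T.cnt fun x => ¬ D 0 x
      · have k1 := cnt_and_add_cnt_and_not (fun x => ¬ D 0 x) e T
        have k2 := cnt_and_add_cnt_and_not (fun x => ¬ ¬ D 0 x) e T
        have k3 := cnt_add_cnt_not (fun x => ¬ D 0 x) T
        have k4 := cnt_and_add_cnt_and_not e (fun x => ¬ D 0 x) T
        simp only [and_comm (a := e _)] at k4
        obtain ⟨a, ha, b, hb, c, hc, d, hd, h1, h2, h3, h4⟩ :=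
          exists_class_sizes_s16 (N := N)
            (A := T.cnt fun x => ¬ D 0 x ∧ e x) (B := T.cnt fun x => ¬ D 0 x ∧ ¬ e x)
            (C := T.cnt fun x => ¬ ¬ D 0 x ∧ e x) (E := T.cnt fun x => ¬ ¬ D 0 x ∧ ¬ e x)
            hN hN4 (by omega) (by omega) (by omega)
        obtain ⟨T', hT', g1, g2, g3⟩ := exists_le_counts (fun x => ¬ D 0 x) e ha hb hc hd
        exact ⟨T', hT', by omega, evenLead_of_pos (by rwa [g2]) (by omega), by omega⟩
      · have hsum := cnt_add_cnt_not (D 0) T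
        obtain ⟨T', hT', h1, h2, h3⟩ := ih (fun i => D (i + 1)) (T.filter (D 0))
          (by rw [← Multiset.cnt_eq_card_filter]; omega)
        exact ⟨T', hT'.trans (Multiset.filter_le _ _), h1, evenLead_succ
          (fun x hx => (Multiset.mem_filter.1 (Multiset.mem_of_le hT' hx)).2) h2, h3⟩
    · have hsum := cnt_add_cnt_not e T
      obtain ⟨T', hT', h1, h2⟩ := exists_evenLead hN (by omega) (r + 1) D
        (T.filter fun x => ¬ e x) (by rw [← Multiset.cnt_eq_card_filter]; omega)
      refine ⟨T', hT'.trans (Multiset.filter_le _ _), h1, h2, ?_⟩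
      rw [Multiset.cnt_eq_zero.2 fun x hx =>
        (Multiset.mem_filter.1 (Multiset.mem_of_le hT' hx)).2]
      exact zero_ne_one

/-- Structure of the multisets of the critical size without a submultiset of size `N` satisfying
the parity condition. -/
theorem exists_chain_of_forall_not_evenLead {N : ℕ} (hN : Even N) (hN0 : 0 < N) (r : ℕ)
    (D : ℕ → α → Prop) (T : Multiset α) (hT : T.card = N + r)
    (h : ∀ T' ≤ T, T'.card = N → ¬ EvenLead (r + 1) D T') :
    ∃ (y : Fin r → α) (M Z : Multiset α), T = (List.ofFn y : Multiset α) + (M + Z) ∧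
      (∀ i : Fin r, (∀ j < (i : ℕ), D j (y i)) ∧ ¬ D i (y i)) ∧
      (∀ x ∈ M, (∀ j < r, D j x) ∧ ¬ D r x) ∧ (∀ x ∈ Z, ∀ j < r + 1, D j x) ∧
      Odd M.card ∧ M.card + Z.card = N := by
  induction r generalizing D T with
  | zero =>
    refine ⟨Fin.elim0, T.filter fun x => ¬ D 0 x, T.filter fun x => ¬ ¬ D 0 x, ?_,
      fun i => i.elim0, ?_, ?_, ?_, ?_⟩
    · simp only [List.ofFn_zero, Multiset.coe_nil, zero_add]
      exact (Multiset.filter_add_not _ T).symm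
    · intro x hx
      exact ⟨fun j hj => absurd hj (by omega), (Multiset.mem_filter.1 hx).2⟩
    · intro x hx j hj
      obtain rfl : j = 0 := by omega
      exact not_not.1 (Multiset.mem_filter.1 hx).2
    · rw [← Nat.not_even_iff_odd, ← Multiset.cnt_eq_card_filter]
      intro hev
      refine h T le_rfl hT fun j hj _ => ?_
      obtain rfl : j = 0 := by omega
      exact hev
    · rw [← Multiset.card_add, Multiset.filter_add_not, hT, add_zero]
  | succ r ih =>
    have hsum := cnt_add_cnt_not (D 0) T
    have hlt : (T.cnt fun x => ¬ D 0 x) < 2 := by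
      by_contra! ho
      obtain ⟨T', hT', h1, h2⟩ := exists_evenLead_of_two_le (r + 1 + 1) hN hN0 (by omega) ho
      exact h T' hT' h1 h2
    have hlift : ∀ T' ≤ T.filter (D 0), T'.card = N →
        ¬ EvenLead (r + 1) (fun i => D (i + 1)) T' := fun T' hT' h1 h2 =>
      h T' (hT'.trans (Multiset.filter_le _ _)) h1 (evenLead_succ
        (fun x hx => (Multiset.mem_filter.1 (Multiset.mem_of_le hT' hx)).2) h2)
    have hne : (T.cnt fun x => ¬ D 0 x) ≠ 0 := by
      intro h0
      obtain ⟨T', hT', h1, h2⟩ := exists_evenLead hN hN0 (r + 1) (fun i => D (i + 1))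
        (T.filter (D 0)) (by rw [← Multiset.cnt_eq_card_filter]; omega)
      exact hlift T' hT' h1 h2
    obtain ⟨z, hz⟩ := Multiset.card_eq_one.1
      (show (T.filter fun x => ¬ D 0 x).card = 1 by
        rw [← Multiset.cnt_eq_card_filter]; omega)
    have hzD : ¬ D 0 z := by
      have hmem : z ∈ T.filter fun x => ¬ D 0 x := hz ▸ Multiset.mem_singleton_self z
      exact (Multiset.mem_filter.1 hmem).2
    have hTD : ∀ x ∈ T.filter (D 0), D 0 x := fun x hx => (Multiset.mem_filter.1 hx).2
    obtain ⟨y, M, Z, hdec, hy, hM, hZ, hodd, hcard⟩ := ih (fun i => D (i + 1)) (T.filter (D 0))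
      (by rw [← Multiset.cnt_eq_card_filter]; omega) hlift
    refine ⟨Fin.cons z y, M, Z, ?_, ?_, ?_, ?_, hodd, hcard⟩
    · rw [← Multiset.filter_add_not (D 0) T, hz, List.ofFn_succ, hdec]
      simp only [Fin.cons_zero, Fin.cons_succ, ← Multiset.cons_coe, ← Multiset.singleton_add]
      abel
    · intro i
      refine Fin.cases ?_ (fun i => ?_) i
      · exact ⟨fun j hj => absurd hj (by simp), hzD⟩
      · simp only [Fin.cons_succ, Fin.val_succ]
        exact ⟨forall_lt_succ_of_shift (hTD _ (by rw [hdec]; simp)) (hy i).1, (hy i).2⟩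
    · intro x hx
      exact ⟨forall_lt_succ_of_shift (hTD _ (by rw [hdec]; simp [hx])) (hM x hx).1, (hM x hx).2⟩
    · intro x hx
      exact forall_lt_succ_of_shift (hTD _ (by rw [hdec]; simp [hx])) (hZ x hx)

/-- Structure of the multisets with exactly two terms failing `D 0`, of the critical size, all of
whose submultisets of size `N` satisfying the parity condition have exactly one term in `e`. -/
theorem exists_chain_of_cnt_eq_two {N : ℕ} (hN : Even N) (hN4 : 4 ≤ N) (e : α → Prop) (r : ℕ)
    (D : ℕ → α → Prop) (T : Multiset α) (hT : T.card = N + (r + 2))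
    (h2 : (T.cnt fun x => ¬ D 0 x) = 2)
    (h : ∀ T' ≤ T, T'.card = N → EvenLead (r + 2) D T' → T'.cnt e = 1) :
    ∃ (z z' : α) (y : Fin r → α) (M Z : Multiset α),
      T = {z} + ({z'} + ((List.ofFn y : Multiset α) + (M + Z))) ∧
      (¬ D 0 z ∧ e z) ∧ (¬ D 0 z' ∧ ¬ e z') ∧
      (∀ i : Fin r, (∀ j < (i : ℕ) + 1, D j (y i)) ∧ ¬ D (i + 1) (y i) ∧ ¬ e (y i)) ∧
      (∀ x ∈ M, (∀ j < r + 1, D j x) ∧ ¬ D (r + 1) x ∧ ¬ e x) ∧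
      (∀ x ∈ Z, (∀ j < r + 2, D j x) ∧ ¬ e x) ∧
      Odd M.card ∧ M.card + Z.card = N := by
  have k1 := cnt_and_add_cnt_and_not (fun x => ¬ D 0 x) e T
  have k2 := cnt_and_add_cnt_and_not (fun x => ¬ ¬ D 0 x) e T
  have k3 := cnt_add_cnt_not (fun x => ¬ D 0 x) T
  have hnone : ∀ a ≤ (T.cnt fun x => ¬ D 0 x ∧ e x), ∀ b ≤ (T.cnt fun x => ¬ D 0 x ∧ ¬ e x),
      ∀ c ≤ (T.cnt fun x => ¬ ¬ D 0 x ∧ e x), ∀ d ≤ (T.cnt fun x => ¬ ¬ D 0 x ∧ ¬ e x),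
      a + b = 2 → c + d + 2 = N → a + c = 1 := by
    intro a ha b hb c hc d hd hab hcd
    obtain ⟨T', hT', g1, g2, g3⟩ := exists_le_counts (fun x => ¬ D 0 x) e ha hb hc hd
    rw [← g3]
    exact h T' hT' (by omega) (evenLead_of_pos (by rw [g2, hab]; exact even_two) (by omega))
  obtain ⟨hA, hB, hC⟩ : (T.cnt fun x => ¬ D 0 x ∧ e x) = 1 ∧
      (T.cnt fun x => ¬ D 0 x ∧ ¬ e x) = 1 ∧ (T.cnt fun x => ¬ ¬ D 0 x ∧ e x) = 0 := by
    generalize (T.cnt fun x => ¬ D 0 x ∧ e x) = A at *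
    generalize (T.cnt fun x => ¬ D 0 x ∧ ¬ e x) = B at *
    generalize (T.cnt fun x => ¬ ¬ D 0 x ∧ e x) = C at *
    generalize (T.cnt fun x => ¬ ¬ D 0 x ∧ ¬ e x) = E at *
    by_contra hcon
    have m1 := hnone A le_rfl B le_rfl
    rcases (by omega : A = 2 ∨ A = 0 ∧ C ≤ 1 ∨ A = 0 ∧ 2 ≤ C ∨ A = 1 ∧ 0 < C) with
      hA | hA | hA | hA
    · have := m1 (min C (N - 2)) (by omega) (N - 2 - min C (N - 2)) (by omega)
      omega
    · have := m1 0 (by omega) (N - 2) (by omega)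
      omega
    · have := m1 (min C (N - 2)) (by omega) (N - 2 - min C (N - 2)) (by omega)
      omega
    · have := m1 (min C (N - 2)) (by omega) (N - 2 - min C (N - 2)) (by omega)
      omega
  rw [Multiset.cnt_eq_card_filter] at hA hB
  obtain ⟨z, hz⟩ := Multiset.card_eq_one.1 hA
  obtain ⟨z', hz'⟩ := Multiset.card_eq_one.1 hB
  have hzmem : z ∈ T.filter fun x => ¬ D 0 x ∧ e x := hz ▸ Multiset.mem_singleton_self z
  have hzmem' : z' ∈ T.filter fun x => ¬ D 0 x ∧ ¬ e x := hz' ▸ Multiset.mem_singleton_self z'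
  have hTD : ∀ x ∈ T.filter (D 0), D 0 x ∧ ¬ e x := fun x hx => by
    rw [Multiset.mem_filter] at hx
    exact ⟨hx.2, fun hex => Multiset.cnt_eq_zero.1 hC x hx.1 ⟨not_not.2 hx.2, hex⟩⟩
  have hdecT : T = {z} + ({z'} + T.filter (D 0)) := by
    conv_lhs => rw [← Multiset.filter_add_not (D 0) T,
      ← Multiset.filter_add_not e (T.filter fun x => ¬ D 0 x)]
    simp only [Multiset.filter_filter, and_comm (a := e _), and_comm (a := ¬ e _), hz, hz']
    abel
  have hcardD : (T.filter (D 0)).card = N + r := by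
    have := congrArg Multiset.card hdecT
    simp only [Multiset.card_add, Multiset.card_singleton] at this
    omega
  obtain ⟨y, M, Z, hdec, hy, hM, hZ, hodd, hcard⟩ := exists_chain_of_forall_not_evenLead hN
    (by omega) r (fun i => D (i + 1)) (T.filter (D 0)) hcardD fun T' hT' h1 h2 => by
      have h3 := h T' (hT'.trans (Multiset.filter_le _ _)) h1
        (evenLead_succ (fun x hx => (hTD x (Multiset.mem_of_le hT' hx)).1) h2)
      rw [Multiset.cnt_eq_zero.2 fun x hx => (hTD x (Multiset.mem_of_le hT' hx)).2] at h3
      exact zero_ne_one h3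
  refine ⟨z, z', y, M, Z, by rw [← hdec]; exact hdecT, (Multiset.mem_filter.1 hzmem).2,
    (Multiset.mem_filter.1 hzmem').2, fun i => ?_, fun x hx => ?_, fun x hx => ?_, hodd, hcard⟩
  · have hmem := hTD (y i) (by rw [hdec]; simp)
    exact ⟨forall_lt_succ_of_shift hmem.1 (hy i).1, (hy i).2, hmem.2⟩
  · have hmem := hTD x (by rw [hdec]; simp [hx])
    exact ⟨forall_lt_succ_of_shift hmem.1 (hM x hx).1, (hM x hx).2, hmem.2⟩
  · have hmem := hTD x (by rw [hdec]; simp [hx])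
    exact ⟨forall_lt_succ_of_shift hmem.1 (hZ x hx), hmem.2⟩

end Combinatorics

section UnitWeights

/-- `s` is a sum of the terms of `M` weighted by units. -/
def HasUnitSum {R : Type*} [CommRing R] (M : Multiset R) (s : R) : Prop :=
  ∃ M', Multiset.Rel Associated M M' ∧ M'.sum = s

theorem Multiset.rel_coe_left {α β : Type*} {r : α → β → Prop} {l : List α} {M : Multiset β} :
    Multiset.Rel r (l : Multiset α) M ↔ ∃ l', List.Forall₂ r l l' ∧ (l' : Multiset β) = M := by
  induction l generalizing M with
  | nil => simp [eq_comm]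
  | cons x l ih =>
    rw [← Multiset.cons_coe, Multiset.rel_cons_left]
    constructor
    · rintro ⟨b, M', hb, hM', rfl⟩
      obtain ⟨l', hl', rfl⟩ := ih.1 hM'
      exact ⟨b :: l', .cons hb hl', by simp⟩
    · rintro ⟨_, hl, rfl⟩
      cases hl with
      | cons hb hl' => exact ⟨_, _, hb, ih.2 ⟨_, hl', rfl⟩, by simp⟩

theorem Multiset.Rel.exists_le {α β : Type*} {r : α → β → Prop} {s s' : Multiset α}
    {t : Multiset β} (h : Multiset.Rel r s t) (hs : s' ≤ s) : ∃ t' ≤ t, Multiset.Rel r s' t' := by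
  obtain ⟨u, rfl⟩ := Multiset.le_iff_exists_add.1 hs
  obtain ⟨t', u', ht', -, rfl⟩ := Multiset.rel_add_left.1 h
  exact ⟨t', Multiset.le_add_right _ _, ht'⟩

theorem rel_associated_refl {R : Type*} [CommRing R] (M : Multiset R) :
    Multiset.Rel Associated M M :=
  Multiset.rel_refl_of_refl_on fun x _ => Associated.refl x

theorem rel_associated_symm {R : Type*} [CommRing R] {M M' : Multiset R}
    (h : Multiset.Rel Associated M M') : Multiset.Rel Associated M' M :=
  Multiset.rel_flip.1 (h.mono fun _ _ _ _ hab => hab.symm)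

theorem HasUnitSum.of_rel {R : Type*} [CommRing R] {M M' : Multiset R} {s : R}
    (hM : HasUnitSum M s) (h : Multiset.Rel Associated M M') : HasUnitSum M' s := by
  obtain ⟨L, hL, hs⟩ := hM
  exact ⟨L, Multiset.Rel.trans _ (rel_associated_symm h) hL, hs⟩

theorem hasUnitSum_cons {R : Type*} [CommRing R] {x : R} {M : Multiset R} {s : R} :
    HasUnitSum (x ::ₘ M) s ↔ ∃ y t, Associated x y ∧ HasUnitSum M t ∧ y + t = s := by
  constructor
  · rintro ⟨L, hL, rfl⟩
    obtain ⟨y, L', hy, hL', rfl⟩ := Multiset.rel_cons_left.1 hL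
    exact ⟨y, L'.sum, hy, ⟨L', hL', rfl⟩, by simp⟩
  · rintro ⟨y, t, hy, ⟨L, hL, rfl⟩, rfl⟩
    exact ⟨y ::ₘ L, .cons hy hL, by simp⟩

theorem exists_zipWith_iff {n : ℕ} {S : List (ZMod n)} {P : List (ZMod n) → Prop} :
    (∃ w : List (ZMod n), w.length = S.length ∧ (∀ a ∈ w, a ∈ U n) ∧
      P (List.zipWith (· * ·) w S)) ↔ ∃ l, List.Forall₂ Associated S l ∧ P l := by
  constructor
  · rintro ⟨w, hw, hU, hP⟩
    refine ⟨_, ?_, hP⟩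
    clear hP
    induction S generalizing w with
    | nil => simp
    | cons x S ih =>
      cases w with
      | nil => simp at hw
      | cons a w =>
        obtain ⟨u, rfl⟩ := hU a (by simp)
        exact .cons ⟨u, mul_comm _ _⟩ (ih w (by simpa using hw) fun b hb => hU b (by simp [hb]))
  · rintro ⟨l, hl, hP⟩
    suffices ∃ w : List (ZMod n), w.length = S.length ∧ (∀ a ∈ w, a ∈ U n) ∧
        List.zipWith (· * ·) w S = l by
      obtain ⟨w, hw, hU, rfl⟩ := this
      exact ⟨w, hw, hU, hP⟩
    clear hP
    induction hl with
    | nil => exact ⟨[], rfl, by simp, rfl⟩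
    | cons hxy _ ih =>
      obtain ⟨u, rfl⟩ := hxy
      obtain ⟨w, hw, hU, rfl⟩ := ih
      refine ⟨(u : ZMod n) :: w, by simp [hw], ?_, by simp [mul_comm]⟩
      intro a ha
      rcases List.mem_cons.1 ha with rfl | ha
      · exact u.isUnit
      · exact hU a ha

theorem isWZSum_iff_s16 {n : ℕ} {T : List (ZMod n)} :
    IsWZSum (U n) T ↔ HasUnitSum (T : Multiset (ZMod n)) 0 := by
  rw [IsWZSum, exists_zipWith_iff (P := fun l => l.sum = 0), HasUnitSum]
  constructor
  · rintro ⟨l, hl, h⟩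
    exact ⟨l, Multiset.rel_coe_left.2 ⟨l, hl, rfl⟩, by simpa using h⟩
  · rintro ⟨M, hM, h⟩
    obtain ⟨l, hl, rfl⟩ := Multiset.rel_coe_left.1 hM
    exact ⟨l, hl, by simpa using h⟩

theorem hasWZSS_iff {n t : ℕ} {S : List (ZMod n)} : HasWZSS (U n) S t ↔
    0 < t ∧ ∃ M ≤ (S : Multiset (ZMod n)), M.card = t ∧ HasUnitSum M 0 := by
  refine and_congr_right fun _ => ⟨?_, ?_⟩
  · rintro ⟨T, hT, hc, h⟩
    exact ⟨T, hT.subperm, by simpa using hc, isWZSum_iff_s16.1 h⟩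
  · rintro ⟨M, hM, hc, h⟩
    induction M using Quotient.inductionOn with
    | _ l =>
      obtain ⟨l', hl', hsub⟩ := Multiset.coe_le.1 hM
      refine ⟨l', hsub, by rw [hl'.length_eq]; simpa using hc, isWZSum_iff_s16.2 ?_⟩
      rwa [Multiset.coe_eq_coe.2 hl']

theorem aEquiv_iff {n : ℕ} {S T : List (ZMod n)} : AEquiv (U n) S T ↔
    Multiset.Rel Associated (S : Multiset (ZMod n)) (T : Multiset (ZMod n)) := by
  have key := fun c : ZMod n =>
    exists_zipWith_iff (S := S) (P := fun l => (T.map fun y => c * y).Perm l)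
  simp only [AEquiv, key]
  constructor
  · rintro ⟨c, ⟨u, rfl⟩, l, hl, hperm⟩
    have h1 : Multiset.Rel Associated (S : Multiset (ZMod n))
        ((T : Multiset (ZMod n)).map fun y => (u : ZMod n) * y) :=
      Multiset.rel_coe_left.2 ⟨l, hl, by simpa using (Multiset.coe_eq_coe.2 hperm).symm⟩
    refine Multiset.Rel.trans _ h1 (Multiset.rel_map_left.2 ?_)
    exact Multiset.rel_refl_of_refl_on fun x _ => ⟨u⁻¹, by simp [mul_comm]⟩
  · intro h
    obtain ⟨l, hl, hlT⟩ := Multiset.rel_coe_left.1 h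
    exact ⟨1, isUnit_one, l, hl, by simpa using (Multiset.coe_eq_coe.1 hlT).symm⟩

theorem associated_of_ringEquiv {R A B : Type*} [CommRing R] [CommRing A] [CommRing B]
    (φ : R ≃+* A × B) {x y : R} (h1 : Associated (φ x).1 (φ y).1)
    (h2 : Associated (φ x).2 (φ y).2) : Associated x y := by
  obtain ⟨u, hu⟩ := h1
  obtain ⟨v, hv⟩ := h2
  have hw : IsUnit (φ.symm ((u : A), (v : B))) :=
    (Prod.isUnit_iff.2 ⟨u.isUnit, v.isUnit⟩ : IsUnit ((u : A), (v : B))).map φ.symm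
  refine ⟨hw.unit, φ.injective ?_⟩
  ext <;> simp [hu, hv]

theorem hasUnitSum_of_ringEquiv {R A B : Type*} [CommRing R] [CommRing A] [CommRing B]
    (φ : R ≃+* A × B) {M : Multiset R} {s : R}
    (h1 : HasUnitSum (M.map fun x => (φ x).1) (φ s).1)
    (h2 : HasUnitSum (M.map fun x => (φ x).2) (φ s).2) : HasUnitSum M s := by
  induction M using Multiset.induction_on generalizing s with
  | empty =>
    obtain ⟨L, hL, hs⟩ := h1
    obtain ⟨L', hL', hs'⟩ := h2
    rw [Multiset.map_zero, Multiset.rel_zero_left] at hL hL'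
    subst hL hL'
    refine ⟨0, .zero, φ.injective ?_⟩
    ext <;> simpa
  | cons x M ih =>
    rw [Multiset.map_cons, hasUnitSum_cons] at h1 h2
    obtain ⟨y, t, hy, ht, hyt⟩ := h1
    obtain ⟨y', t', hy', ht', hyt'⟩ := h2
    refine hasUnitSum_cons.2 ⟨φ.symm (y, y'), φ.symm (t, t'),
      associated_of_ringEquiv φ (by simpa) (by simpa), ih (by simpa) (by simpa),
      φ.injective ?_⟩
    ext <;> simpa

theorem exists_eq_two_mul_or {r : ℕ} (z : ZMod (2 ^ r)) :
    (∃ t, z = 2 * t) ∨ ∃ t, z = 1 + 2 * t := by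
  obtain ⟨k, rfl⟩ := ZMod.natCast_zmod_surjective z
  rcases Nat.even_or_odd' k with ⟨c, rfl | rfl⟩
  · exact .inl ⟨c, by push_cast; ring⟩
  · exact .inr ⟨c, by push_cast; ring⟩

theorem two_pow_eq_zero (r : ℕ) : (2 : ZMod (2 ^ r)) ^ r = 0 := by
  exact_mod_cast ZMod.natCast_self (2 ^ r)

theorem isUnit_one_add_two_mul {r : ℕ} (t : ZMod (2 ^ r)) : IsUnit (1 + 2 * t) :=
  IsNilpotent.isUnit_one_add ⟨r, by rw [mul_pow, two_pow_eq_zero, zero_mul]⟩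

/-- An element of `ZMod (2 ^ r)` of exact 2-adic valuation `j` is associated to `2 ^ j`. -/
theorem associated_two_pow {r j : ℕ} {x : ZMod (2 ^ r)} (h : ∀ i < j, 2 ^ (i + 1) ∣ x)
    (hj : ¬ 2 ^ (j + 1) ∣ x) : Associated x (2 ^ j) := by
  obtain ⟨y, rfl⟩ : 2 ^ j ∣ x := by
    cases j with
    | zero => simp
    | succ j => exact h j (by omega)
  rcases exists_eq_two_mul_or y with ⟨t, rfl⟩ | ⟨t, rfl⟩
  · exact absurd ⟨t, by ring⟩ hj
  · exact (associated_mul_unit_left _ _ (isUnit_one_add_two_mul t))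

theorem exists_sum_eq_two_pow_mul {r j : ℕ} {M : Multiset (ZMod (2 ^ r))}
    (h : ∀ x ∈ M, ∀ i < j, 2 ^ (i + 1) ∣ x) :
    ∃ t, M.sum = 2 ^ j * ((M.cnt fun x => ¬ 2 ^ (j + 1) ∣ x : ℕ) + 2 * t) := by
  induction M using Multiset.induction_on with
  | empty => exact ⟨0, by simp⟩
  | cons x M ih =>
    obtain ⟨t, ht⟩ := ih fun y hy => h y (Multiset.mem_cons_of_mem hy)
    rw [Multiset.sum_cons, ht, Multiset.cnt_cons]
    by_cases hx : 2 ^ (j + 1) ∣ x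
    · obtain ⟨c, hc⟩ := hx
      exact ⟨t + c, by simp only [hc, dvd_mul_right, not_true_eq_false, if_false]; push_cast; ring⟩
    · obtain ⟨u, hu⟩ := (associated_two_pow (h x (Multiset.mem_cons_self x M)) hx).symm
      rcases exists_eq_two_mul_or (u : ZMod (2 ^ r)) with ⟨c, hc⟩ | ⟨c, hc⟩
      · exact absurd ⟨c, by rw [← hu, hc]; ring⟩ hx
      · refine ⟨t + c, ?_⟩
        rw [if_pos hx, ← hu, hc]
        push_cast
        ring

theorem hasUnitSum_zero_of_evenLead {r : ℕ} {M : Multiset (ZMod (2 ^ r))}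
    (h : EvenLead r (fun i x => 2 ^ (i + 1) ∣ x) M) : HasUnitSum M 0 := by
  classical
  by_cases hex : ∃ j, j < r ∧ ∃ x ∈ M, ¬ 2 ^ (j + 1) ∣ x
  · obtain ⟨hjr, x, hx, hjx⟩ := Nat.find_spec hex
    have hmin : ∀ y ∈ M, ∀ i < Nat.find hex, 2 ^ (i + 1) ∣ y := by
      intro y hy i hi
      by_contra hcon
      exact Nat.find_min hex hi ⟨by omega, y, hy, hcon⟩
    have hev := h _ hjr hmin
    obtain ⟨M, rfl⟩ := Multiset.exists_cons_of_mem hx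
    generalize Nat.find hex = j at *
    rw [Multiset.cnt_cons, if_pos hjx] at hev
    obtain ⟨t, ht⟩ := exists_sum_eq_two_pow_mul fun y hy => hmin y (Multiset.mem_cons_of_mem hy)
    obtain ⟨c, hc⟩ : Odd (M.cnt fun x => ¬ 2 ^ (j + 1) ∣ x) := by
      rw [← Nat.not_even_iff_odd]
      exact Nat.even_add_one.1 hev
    refine ⟨-M.sum ::ₘ M, .cons ?_ (rel_associated_refl M), by simp⟩
    refine (associated_two_pow (hmin x hx) hjx).trans (Associated.neg_right ?_)
    have hs : M.sum = 2 ^ j * (1 + 2 * (c + t)) := by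
      rw [ht, hc]
      push_cast
      ring
    rw [hs]
    exact associated_mul_unit_right _ _ (isUnit_one_add_two_mul _)
  · push Not at hex
    refine ⟨M, rel_associated_refl M, Multiset.sum_eq_zero fun x hx => ?_⟩
    cases r with
    | zero => exact Subsingleton.elim (α := ZMod 1) _ _
    | succ r => simpa [two_pow_eq_zero] using hex r (by omega) x hx

theorem hasUnitSum_zero_of_cnt_ne_one {F : Type*} [Field F] (h2 : (2 : F) ≠ 0) {M : Multiset F}
    (h : M.cnt (fun x => x ≠ 0) ≠ 1) : HasUnitSum M 0 := by
  have hassoc : ∀ {x y : F}, x ≠ 0 → y ≠ 0 → Associated x y := fun hx hy =>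
    (associated_one_iff_isUnit.2 hx.isUnit).trans (associated_one_iff_isUnit.2 hy.isUnit).symm
  by_cases h0 : M.cnt (fun x => x ≠ 0) = 0
  · refine ⟨M, rel_associated_refl M, Multiset.sum_eq_zero fun x hx => ?_⟩
    exact not_not.1 (Multiset.cnt_eq_zero.1 h0 x hx)
  obtain ⟨x, hx, hx0⟩ := Multiset.cnt_pos.1 (Nat.pos_of_ne_zero h0)
  obtain ⟨M, rfl⟩ := Multiset.exists_cons_of_mem hx
  rw [Multiset.cnt_cons, if_pos hx0] at h
  obtain ⟨y, hy, hy0⟩ := (Multiset.cnt_pos (P := fun x : F => x ≠ 0) (T := M)).1 (by omega)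
  obtain ⟨M, rfl⟩ := Multiset.exists_cons_of_mem hy
  obtain ⟨z, hz0, hz⟩ : ∃ z : F, z ≠ 0 ∧ -M.sum - z ≠ 0 := by
    by_cases hs : -M.sum - 1 = 0
    · refine ⟨-1, by simp, ?_⟩
      rw [sub_eq_zero.1 hs]
      norm_num [h2]
    · exact ⟨1, one_ne_zero, hs⟩
  exact ⟨z ::ₘ (-M.sum - z) ::ₘ M, .cons (hassoc hx0 hz0) (.cons (hassoc hy0 hz)
    (rel_associated_refl M)), by simp only [Multiset.sum_cons]; ring⟩

theorem cnt_map {α β : Type*} (f : α → β) (P : β → Prop) (M : Multiset α) :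
    (M.map f).cnt P = M.cnt fun x => P (f x) := by
  classical
  induction M using Multiset.induction_on with
  | empty => simp
  | cons x M ih => simp [Multiset.cnt_cons, ih]

theorem evenLead_map {α β : Type*} (f : α → β) {r : ℕ} {D : ℕ → β → Prop} {M : Multiset α} :
    EvenLead r D (M.map f) ↔ EvenLead r (fun i x => D i (f x)) M := by
  simp [EvenLead, cnt_map]

end UnitWeights

section AstSequences

/-- The sequence
`(b 1, q 1 * b 2, ..., q 1 * ... * q (k-1) * b k, n/2, ..., n/2, 0, ..., 0)` in `ZMod n`. -/
def astSeq (n k : ℕ) (q : Fin k → ℕ) (b : Fin k → ℤ) (m : ℕ) : List (ZMod n) :=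
  (List.ofFn fun i : Fin k => (((∏ j ∈ Finset.Iio i, (q j : ℤ)) * b i : ℤ) : ZMod n)) ++
    (List.replicate m ((n / 2 : ℕ) : ZMod n) ++ List.replicate (n - m) (0 : ZMod n))

theorem length_astSeq {n k : ℕ} (q : Fin k → ℕ) (b : Fin k → ℤ) {m : ℕ} (hm : m ≤ n) :
    (astSeq n k q b m).length = n + k := by
  simp only [astSeq, List.length_append, List.length_ofFn, List.length_replicate]
  omega

theorem prod_Iio_fin_succ {M : Type*} [CommMonoid M] {k : ℕ} (f : Fin (k + 1) → M) (i : Fin k) :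
    ∏ j ∈ Finset.Iio i.succ, f j = f 0 * ∏ j ∈ Finset.Iio i, f j.succ := by
  have key : ∀ {l : ℕ} (g : Fin l → M) (a : Fin l),
      ∏ j ∈ Finset.Iio a, g j = ∏ j, if j < a then g j else 1 := by
    intro l g a
    rw [← Finset.prod_filter]
    congr 1
    ext j
    simp
  rw [key, key, Fin.prod_univ_succ]
  simp

theorem dvd_of_hasUnitSum {R : Type*} [CommRing R] {c s : R} {M : Multiset R}
    (hM : ∀ x ∈ M, c ∣ x) (h : HasUnitSum M s) : c ∣ s := by
  induction M using Multiset.induction_on generalizing s with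
  | empty =>
    obtain ⟨L, hL, rfl⟩ := h
    simp [Multiset.rel_zero_left.1 hL]
  | cons x M ih =>
    obtain ⟨y, t, hy, ht, rfl⟩ := hasUnitSum_cons.1 h
    exact dvd_add (hy.dvd_iff_dvd_right.1 (hM x (Multiset.mem_cons_self x M)))
      (ih (fun z hz => hM z (Multiset.mem_cons_of_mem hz)) ht)

theorem intCast_dvd_of_dvd {n c : ℕ} (hc : c ∣ n) {a : ℤ} (h : (c : ZMod n) ∣ (a : ZMod n)) :
    (c : ℤ) ∣ a := by
  have h' := map_dvd (ZMod.castHom hc (ZMod c)) h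
  rw [map_natCast, map_intCast, ZMod.natCast_self, zero_dvd_iff] at h'
  exact (ZMod.intCast_zmod_eq_zero_iff_dvd a c).1 h'

/-- A zero-sum subsequence cannot use any of the leading terms of the sequence. -/
theorem le_of_hasUnitSum_zero {n : ℕ} (hn : n ≠ 0) {k : ℕ} (q : Fin k → ℕ) (b : Fin k → ℤ)
    (hq : ∀ i, (q i).Prime) (hb : ∀ i, IsCoprime (b i) (q i : ℤ)) (d : ℕ)
    (hd : d * ∏ i, q i ∣ n) {R T : Multiset (ZMod n)}
    (hR : ∀ x ∈ R, ((d * ∏ i, q i : ℕ) : ZMod n) ∣ x)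
    (hT : T ≤ ((List.ofFn fun i : Fin k =>
      ((d * (∏ j ∈ Finset.Iio i, (q j : ℤ)) * b i : ℤ) : ZMod n) : List (ZMod n)) :
        Multiset (ZMod n)) + R)
    (h : HasUnitSum T 0) : T ≤ R := by
  induction k generalizing d with
  | zero => simpa using hT
  | succ k ih =>
    have hprod : d * ∏ i, q i = d * q 0 * ∏ i : Fin k, q i.succ := by
      rw [Fin.prod_univ_succ, mul_assoc]
    rw [hprod] at hd hR
    rw [List.ofFn_succ, ← Multiset.cons_coe, Multiset.cons_add] at hT
    have hterm : ∀ i : Fin k, ((d * (∏ j ∈ Finset.Iio i.succ, (q j : ℤ)) * b i.succ : ℤ) : ZMod n) =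
        (((d * q 0 : ℕ) * (∏ j ∈ Finset.Iio i, (q j.succ : ℤ)) * b i.succ : ℤ) : ZMod n) := by
      intro i
      rw [prod_Iio_fin_succ]
      push_cast
      ring
    simp only [hterm] at hT
    refine ih (fun i => q i.succ) (fun i => b i.succ) (fun i => hq _) (fun i => hb _) (d * q 0)
      hd hR ?_
    by_contra hnot
    obtain ⟨T, rfl⟩ := Multiset.exists_cons_of_mem
      (not_imp_comm.1 (fun hx => (Multiset.le_cons_of_notMem hx).1 hT) hnot)
    rw [Multiset.cons_le_cons_iff] at hT
    obtain ⟨y, t, hy, ht, hyt⟩ := hasUnitSum_cons.1 h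
    have hdt : ((d * q 0 : ℕ) : ZMod n) ∣ t := by
      refine dvd_of_hasUnitSum (fun x hx => ?_) ht
      rcases Multiset.mem_add.1 (Multiset.mem_of_le hT hx) with hx | hx
      · obtain ⟨i, rfl⟩ := List.mem_ofFn.1 (Multiset.mem_coe.1 hx)
        refine ⟨(((∏ j ∈ Finset.Iio i, (q j.succ : ℤ)) * b i.succ : ℤ) : ZMod n), ?_⟩
        push_cast
        ring
      · refine dvd_trans ?_ (hR x hx)
        exact_mod_cast Nat.cast_dvd_cast (Dvd.intro _ rfl)
    have hdx := hy.dvd_iff_dvd_right.2 ((dvd_add_left hdt).1 (hyt ▸ dvd_zero _))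
    have hdvd_int := intCast_dvd_of_dvd ((Dvd.intro _ rfl).trans hd) hdx
    have hIio : Finset.Iio (0 : Fin (k + 1)) = ∅ := by
      ext j
      simp
    rw [hIio, Finset.prod_empty, mul_one] at hdvd_int
    push_cast at hdvd_int
    have hd0 : (d : ℤ) ≠ 0 := by
      rintro hd0
      obtain rfl : d = 0 := by exact_mod_cast hd0
      simp only [zero_mul, zero_dvd_iff] at hd
      exact hn hd
    have hdvd := (mul_dvd_mul_iff_left hd0).1 hdvd_int
    have hunit := (hb 0).isUnit_of_dvd' hdvd dvd_rfl
    exact (Nat.prime_iff_prime_int.1 (hq 0)).not_isUnit hunit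

theorem not_hasUnitSum_half {n m : ℕ} (hn : n ≠ 0) (h2 : 2 ∣ n) (hm : Odd m) (l : ℕ) :
    ¬ HasUnitSum (Multiset.replicate m ((n / 2 : ℕ) : ZMod n) + Multiset.replicate l 0) 0 := by
  rintro ⟨L', hL', hs⟩
  obtain ⟨L, Z, hL, hZ, rfl⟩ := Multiset.rel_add_left.1 hL'
  rw [Multiset.rel_replicate_left] at hL hZ
  obtain ⟨h, rfl⟩ := h2
  have : NeZero (2 * h) := ⟨hn⟩
  have hassoc : ∀ x ∈ L, x = (h : ZMod (2 * h)) := by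
    intro x hx
    obtain ⟨u, rfl⟩ := hL.2 x hx
    obtain ⟨v, hv⟩ := ZMod.natCast_zmod_surjective (u : ZMod (2 * h))
    have hcop := (ZMod.isUnit_iff_coprime v (2 * h)).1 (hv ▸ u.isUnit)
    obtain ⟨c, rfl⟩ : Odd v := (Nat.Coprime.coprime_mul_right_right hcop).symm.odd_of_left
    have h0 : ((2 * h : ℕ) : ZMod (2 * h)) = 0 := ZMod.natCast_self _
    rw [← hv, Nat.mul_div_cancel_left _ two_pos]
    push_cast at h0 ⊢
    linear_combination (c : ZMod (2 * h)) * h0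
  have hzero : ∀ x ∈ Z, x = 0 := fun x hx => by
    obtain ⟨u, rfl⟩ := hZ.2 x hx
    exact zero_mul _
  rw [Multiset.eq_replicate.2 ⟨hL.1, hassoc⟩, Multiset.sum_add, Multiset.sum_replicate,
    Multiset.sum_eq_zero hzero, add_zero, nsmul_eq_mul] at hs
  obtain ⟨c, rfl⟩ := hm
  have hdvd : 2 * h ∣ (2 * c + 1) * h := by
    rw [← ZMod.natCast_eq_zero_iff]
    exact_mod_cast hs
  obtain ⟨e, he⟩ := hdvd
  have hh : h ≠ 0 := by rintro rfl; simp at hn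
  have : 2 * c + 1 = 2 * e := Nat.eq_of_mul_eq_mul_right (Nat.pos_of_ne_zero hh) (by linarith)
  omega

theorem not_hasWZSS_astSeq {n k : ℕ} (hn : n ≠ 0) {q : Fin k → ℕ} {b : Fin k → ℤ} {m : ℕ}
    (hq : ∀ i, (q i).Prime) (hprod : n = 2 * ∏ i, q i) (hb : ∀ i, IsCoprime (b i) (q i : ℤ))
    (hm : Odd m) (hmn : m ≤ n) : ¬ HasWZSS (U n) (astSeq n k q b m) n := by
  rw [hasWZSS_iff]
  rintro ⟨-, T, hT, hcard, h⟩
  have hle := le_of_hasUnitSum_zero hn q b hq hb 1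
    (R := Multiset.replicate m ((n / 2 : ℕ) : ZMod n) + Multiset.replicate (n - m) 0) (T := T)
    (by rw [one_mul]; exact Dvd.intro_left _ hprod.symm) ?_ ?_ h
  · have hTeq := Multiset.eq_of_le_of_card_le hle (by simp [hcard]; omega)
    rw [hTeq] at h
    exact not_hasUnitSum_half hn (Dvd.intro _ hprod.symm) hm _ h
  · intro x hx
    rcases Multiset.mem_add.1 hx with hx | hx
    · rw [Multiset.eq_of_mem_replicate hx, one_mul,
        Nat.div_eq_of_eq_mul_right two_pos hprod]
    · rw [Multiset.eq_of_mem_replicate hx]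
      exact dvd_zero _
  · simpa [astSeq, ← Multiset.coe_add, ← Multiset.coe_replicate] using hT

/-- The primes `p, 2, ..., 2`. -/
def chainPrimes (p s : ℕ) : Fin (s + 1) → ℕ := Fin.cons p fun _ => 2

theorem chainPrimes_prime {p : ℕ} (hp : p.Prime) (s : ℕ) (i : Fin (s + 1)) :
    (chainPrimes p s i).Prime := by
  refine Fin.cases ?_ (fun i => ?_) i
  · exact hp
  · exact Nat.prime_two

theorem two_pow_mul_eq_prod_chainPrimes (p s : ℕ) :
    2 ^ (s + 1) * p = 2 * ∏ i, chainPrimes p s i := by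
  simp [chainPrimes, Fin.prod_univ_succ, pow_succ]
  ring

end AstSequences

section GaoConstant

variable {r p : ℕ}

theorem coprime_two_pow (hp : p.Prime) (hpodd : p ≠ 2) (r : ℕ) : (2 ^ r).Coprime p :=
  Nat.Coprime.pow_left r ((Nat.coprime_primes Nat.prime_two hp).2 (Ne.symm hpodd))

theorem hasUnitSum_zero_of_chineseRemainder (hp : p.Prime) (hpodd : p ≠ 2)
    {M : Multiset (ZMod (2 ^ r * p))}
    (h1 : EvenLead r (fun i x =>
      2 ^ (i + 1) ∣ (ZMod.chineseRemainder (coprime_two_pow hp hpodd r) x).1) M)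
    (h2 : M.cnt (fun x => (ZMod.chineseRemainder (coprime_two_pow hp hpodd r) x).2 ≠ 0) ≠ 1) :
    HasUnitSum M 0 := by
  have : Fact p.Prime := ⟨hp⟩
  refine hasUnitSum_of_ringEquiv (ZMod.chineseRemainder (coprime_two_pow hp hpodd r)) ?_ ?_
  · rw [map_zero]
    exact hasUnitSum_zero_of_evenLead ((evenLead_map _).2 h1)
  · rw [map_zero]
    refine hasUnitSum_zero_of_cnt_ne_one ?_ (by rwa [cnt_map])
    intro h
    have := (ZMod.natCast_eq_zero_iff 2 p).1 (by exact_mod_cast h)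
    exact hpodd ((Nat.prime_dvd_prime_iff_eq hp Nat.prime_two).1 this)

theorem four_le_two_pow_mul (hr : 2 ≤ r) (hp : p.Prime) : 4 ≤ 2 ^ r * p :=
  calc 4 = 2 ^ 2 * 1 := rfl
    _ ≤ 2 ^ r * p := Nat.mul_le_mul (Nat.pow_le_pow_right two_pos hr) hp.one_le

theorem even_two_pow_mul (hr : 2 ≤ r) (p : ℕ) : Even (2 ^ r * p) :=
  ((Nat.even_pow.2 ⟨even_two, by omega⟩).mul_right p)

theorem hasWZSS_of_length_eq (hr : 2 ≤ r) (hp : p.Prime) (hpodd : p ≠ 2)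
    {S : List (ZMod (2 ^ r * p))} (hS : S.length = 2 ^ r * p + r + 1) :
    HasWZSS (U (2 ^ r * p)) S (2 ^ r * p) := by
  have hN4 := four_le_two_pow_mul hr hp
  obtain ⟨T, hT, hcard, h1, h2⟩ := exists_evenLead_cnt_ne_one (even_two_pow_mul hr p) hN4
    (fun x => (ZMod.chineseRemainder (coprime_two_pow hp hpodd r) x).2 ≠ 0) r
    (fun i x => 2 ^ (i + 1) ∣ (ZMod.chineseRemainder (coprime_two_pow hp hpodd r) x).1)
    (S : Multiset (ZMod (2 ^ r * p))) (by simp [hS])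
  exact hasWZSS_iff.2
    ⟨by omega, T, hT, hcard, hasUnitSum_zero_of_chineseRemainder hp hpodd h1 h2⟩

theorem gaoC_eq (hr : 2 ≤ r) (hp : p.Prime) (hpodd : p ≠ 2) :
    GaoC (2 ^ r * p) (U (2 ^ r * p)) = 2 ^ r * p + r + 1 := by
  have hN4 := four_le_two_pow_mul hr hp
  have hmem : 2 ^ r * p + r + 1 ∈ {k | 0 < k ∧ ∀ S : List (ZMod (2 ^ r * p)), S.length = k →
      HasWZSS (U (2 ^ r * p)) S (2 ^ r * p)} :=
    ⟨by omega, fun S hS => hasWZSS_of_length_eq hr hp hpodd hS⟩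
  refine le_antisymm (Nat.sInf_le hmem) (le_csInf ⟨_, hmem⟩ ?_)
  rintro l ⟨-, hl⟩
  by_contra! hlt
  obtain ⟨s, rfl⟩ : ∃ s, r = s + 1 := ⟨r - 1, by omega⟩
  have hlen : (astSeq (2 ^ (s + 1) * p) (s + 1) (chainPrimes p s) (fun _ => 1) 1).length =
      2 ^ (s + 1) * p + (s + 1) := length_astSeq _ _ (by omega)
  obtain ⟨h0, T, hT, hTl, hTs⟩ := hl
    ((astSeq (2 ^ (s + 1) * p) (s + 1) (chainPrimes p s) (fun _ => 1) 1).take l)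
    (by rw [List.length_take]; omega)
  exact not_hasWZSS_astSeq (by omega) (chainPrimes_prime hp s)
    (two_pow_mul_eq_prod_chainPrimes p s) (fun _ => isCoprime_one_left) odd_one (by omega)
    ⟨h0, T, hT.trans (List.take_sublist _ _), hTl, hTs⟩

theorem associated_chain_term (hp : p.Prime) (hpodd : p ≠ 2) {j : ℕ} {x : ZMod (2 ^ r * p)}
    (h : ∀ i < j, 2 ^ (i + 1) ∣ (ZMod.chineseRemainder (coprime_two_pow hp hpodd r) x).1)
    (hj : ¬ 2 ^ (j + 1) ∣ (ZMod.chineseRemainder (coprime_two_pow hp hpodd r) x).1)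
    (he : (ZMod.chineseRemainder (coprime_two_pow hp hpodd r) x).2 = 0) :
    Associated x ((p * 2 ^ j : ℕ) : ZMod (2 ^ r * p)) := by
  refine associated_of_ringEquiv (ZMod.chineseRemainder (coprime_two_pow hp hpodd r)) ?_ ?_
  · refine (associated_two_pow h hj).trans ?_
    obtain ⟨c, rfl⟩ := hp.odd_of_ne_two hpodd
    have hu := isUnit_one_add_two_mul (r := r) (c : ZMod (2 ^ r))
    rw [map_natCast]
    have hval : (((2 * c + 1) * 2 ^ j : ℕ) : ZMod (2 ^ r) × ZMod (2 * c + 1)).1 =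
        (1 + 2 * (c : ZMod (2 ^ r))) * 2 ^ j := by
      rw [Prod.fst_natCast]
      push_cast
      ring
    rw [hval]
    exact associated_unit_mul_right _ _ hu
  · rw [he, map_natCast]
    simp

theorem eq_zero_of_chineseRemainder (hp : p.Prime) (hpodd : p ≠ 2) {x : ZMod (2 ^ r * p)}
    (h : 2 ^ r ∣ (ZMod.chineseRemainder (coprime_two_pow hp hpodd r) x).1)
    (he : (ZMod.chineseRemainder (coprime_two_pow hp hpodd r) x).2 = 0) : x = 0 := by
  rw [two_pow_eq_zero, zero_dvd_iff] at h
  apply (ZMod.chineseRemainder (coprime_two_pow hp hpodd r)).injective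
  ext <;> simp [h, he]

theorem castHom_two_eq_one_iff (hp : p.Prime) (hpodd : p ≠ 2) (h2 : 2 ∣ 2 ^ r * p) (hr : r ≠ 0)
    (x : ZMod (2 ^ r * p)) : ZMod.castHom h2 (ZMod 2) x = 1 ↔
      ¬ 2 ^ (0 + 1) ∣ (ZMod.chineseRemainder (coprime_two_pow hp hpodd r) x).1 := by
  have hcomp : ZMod.castHom h2 (ZMod 2) = ((ZMod.castHom (dvd_pow_self 2 hr) (ZMod 2)).comp
      (RingHom.fst (ZMod (2 ^ r)) (ZMod p))).comp
        (ZMod.chineseRemainder (coprime_two_pow hp hpodd r) : _ →+* _) := Subsingleton.elim _ _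
  have h20 : (2 : ZMod 2) = 0 := rfl
  rw [hcomp]
  simp only [RingHom.comp_apply, RingHom.coe_fst, RingHom.coe_coe, zero_add, pow_one]
  constructor
  · rintro h ⟨t, ht⟩
    rw [ht, map_mul, map_ofNat, h20, zero_mul] at h
    exact zero_ne_one h
  · intro h
    rcases exists_eq_two_mul_or (ZMod.chineseRemainder (coprime_two_pow hp hpodd r) x).1 with
      ⟨t, ht⟩ | ⟨t, ht⟩
    · exact absurd ⟨t, ht⟩ h
    · rw [ht, map_add, map_mul, map_one, map_ofNat, h20, zero_mul, add_zero]

theorem astSeq_chainPrimes (p n s m : ℕ) :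
    (astSeq n (s + 2) (chainPrimes p (s + 1)) (fun _ => 1) m : Multiset (ZMod n)) =
      {1} + ({((p * 2 ^ 0 : ℕ) : ZMod n)} +
        (((List.ofFn fun i : Fin s => ((p * 2 ^ ((i : ℕ) + 1) : ℕ) : ZMod n) : List (ZMod n)) :
          Multiset (ZMod n)) +
          (Multiset.replicate m ((n / 2 : ℕ) : ZMod n) + Multiset.replicate (n - m) 0))) := by
  have hIio : ∀ l : ℕ, Finset.Iio (0 : Fin (l + 1)) = ∅ := fun l => by
    ext j
    simp
  rw [astSeq, List.ofFn_succ, List.ofFn_succ]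
  simp only [prod_Iio_fin_succ, hIio, chainPrimes, Fin.cons_zero, Fin.cons_succ,
    Finset.prod_const, Finset.prod_empty, Finset.card_empty, Fin.card_Iio]
  simp only [Multiset.singleton_add, ← Multiset.coe_add, ← Multiset.cons_coe, Multiset.cons_add,
    ← Multiset.coe_replicate]
  congr 1
  · simp
  congr 1
  · simp
  congr 3
  ext i
  simp only [Fin.val_succ]
  push_cast
  ring

theorem rel_ofFn {α β : Type*} {R : α → β → Prop} {s : ℕ} {f : Fin s → α} {g : Fin s → β}
    (h : ∀ i, R (f i) (g i)) :
    Multiset.Rel R (List.ofFn f : Multiset α) (List.ofFn g : Multiset β) := by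
  refine Multiset.rel_coe_left.2 ⟨_, ?_, rfl⟩
  rw [List.forall₂_iff_get]
  exact ⟨by simp, fun i h1 h2 => by simpa using h _⟩

/-- A sequence with exactly two odd terms and no zero-sum subsequence of length `n` consists,
up to units, of `1, p, 2 * p, ..., 2 ^ (r - 2) * p`, an odd number of terms `n / 2`, and zeros. -/
theorem exists_rel_astSeq_of_two_odd {s : ℕ} (hp : p.Prime) (hpodd : p ≠ 2)
    {S : Multiset (ZMod (2 ^ (s + 2) * p))} (hcard : S.card = 2 ^ (s + 2) * p + (s + 2))
    (hodd : (S.cnt fun x => ¬ 2 ^ (0 + 1) ∣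
      (ZMod.chineseRemainder (coprime_two_pow hp hpodd (s + 2)) x).1) = 2)
    (hS : ∀ T ≤ S, T.card = 2 ^ (s + 2) * p → ¬ HasUnitSum T 0) :
    ∃ m, Odd m ∧ m ≤ 2 ^ (s + 2) * p ∧ Multiset.Rel Associated S
      (astSeq (2 ^ (s + 2) * p) (s + 2) (chainPrimes p (s + 1)) (fun _ => 1) m) := by
  have : Fact p.Prime := ⟨hp⟩
  obtain ⟨z, z', y, M, Z, hdec, hz, hz', hy, hM, hZ, hMo, hMZ⟩ := exists_chain_of_cnt_eq_two
    (even_two_pow_mul (by omega) p) (four_le_two_pow_mul (by omega) hp)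
    (fun x => (ZMod.chineseRemainder (coprime_two_pow hp hpodd (s + 2)) x).2 ≠ 0) s
    (fun i x => 2 ^ (i + 1) ∣ (ZMod.chineseRemainder (coprime_two_pow hp hpodd (s + 2)) x).1) S
    hcard hodd fun T hT hTc h1 => by
      by_contra h2
      exact hS T hT hTc (hasUnitSum_zero_of_chineseRemainder hp hpodd h1 h2)
  have hhalf : 2 ^ (s + 2) * p / 2 = p * 2 ^ (s + 1) :=
    Nat.div_eq_of_eq_mul_right two_pos (by ring)
  refine ⟨M.card, hMo, by omega, ?_⟩
  rw [astSeq_chainPrimes, hdec, hhalf]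
  refine .add ?_ (.add ?_ (.add (rel_ofFn fun i => ?_) (.add ?_ ?_)))
  · refine .cons (associated_of_ringEquiv
      (ZMod.chineseRemainder (coprime_two_pow hp hpodd (s + 2))) ?_ ?_) .zero
    · rw [map_one]
      simpa using associated_two_pow (j := 0) (by simp) hz.1
    · rw [map_one]
      exact associated_one_iff_isUnit.2 (IsUnit.mk0 _ hz.2)
  · exact .cons (associated_chain_term hp hpodd (by simp) hz'.1 (not_not.1 hz'.2)) .zero
  · exact associated_chain_term hp hpodd (hy i).1 (hy i).2.1 (not_not.1 (hy i).2.2)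
  · exact Multiset.rel_replicate_right.2 ⟨rfl, fun x hx =>
      associated_chain_term hp hpodd (hM x hx).1 (hM x hx).2.1 (not_not.1 (hM x hx).2.2)⟩
  · refine Multiset.rel_replicate_right.2 ⟨by omega, fun x hx => ?_⟩
    rw [eq_zero_of_chineseRemainder hp hpodd ((hZ x hx).1 (s + 1) (by omega))
      (not_not.1 (hZ x hx).2)]

theorem eq_of_two_pow_mul_eq (hp : p.Prime) {k : ℕ} {q : Fin k → ℕ} (hq : ∀ i, (q i).Prime)
    (h : 2 ^ r * p = 2 * ∏ i, q i) : k = r := by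
  have hprod : ∏ i, q i ≠ 0 := Finset.prod_ne_zero_iff.2 fun i _ => (hq i).ne_zero
  have hcard := congrArg ArithmeticFunction.cardFactors h
  have hq' : ArithmeticFunction.cardFactors (∏ i, q i) = k := by
    rw [Finset.prod, ArithmeticFunction.cardFactors_multiset_prod hprod, Multiset.map_map]
    exact (Finset.sum_congr rfl fun i _ =>
      ArithmeticFunction.cardFactors_apply_prime (hq i)).trans (by simp)
  rw [ArithmeticFunction.cardFactors_mul (by positivity) hp.ne_zero,
    ArithmeticFunction.cardFactors_mul two_ne_zero hprod,
    ArithmeticFunction.cardFactors_apply_prime_pow Nat.prime_two,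
    ArithmeticFunction.cardFactors_apply_prime hp,
    ArithmeticFunction.cardFactors_apply_prime Nat.prime_two, hq'] at hcard
  omega

theorem not_hasWZSS_of_rel {n t : ℕ} {S T : List (ZMod n)}
    (h : Multiset.Rel Associated (S : Multiset (ZMod n)) (T : Multiset (ZMod n)))
    (hT : ¬ HasWZSS (U n) T t) : ¬ HasWZSS (U n) S t := by
  rw [hasWZSS_iff] at hT ⊢
  rintro ⟨ht, M, hM, hc, h0⟩
  obtain ⟨M', hM', hrel⟩ := h.exists_le hM
  exact hT ⟨ht, M', hM', by rw [← Multiset.card_eq_card_of_rel hrel, hc], h0.of_rel hrel⟩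

end GaoConstant

/-- For `n = 2 ^ r * p`, `p` an odd prime, `r ≥ 2`: a sequence in `ZMod n` with exactly
two odd terms is a `U(n)`-extremal sequence for the Gao constant iff it is
`U(n)`-equivalent to a sequence of the form
`(b 1, q 1 * b 2, ..., q 1 * ... * q (k-1) * b k, n/2, ..., n/2, 0, ..., 0)`, where
`n = 2 * q 1 * ... * q k` with the `q i` prime, each `b i` coprime to `q i`, `n / 2`
occurring an odd number `m` of times and `0` occurring `n - m` times. -/
theorem gao_extremal_iff_ast_of_two_odd (r p : ℕ) (hr : 2 ≤ r) (hp : p.Prime)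
    (hpodd : p ≠ 2) (S : List (ZMod (2 ^ r * p)))
    (h2 : pcount (fun x => ZMod.castHom
        (dvd_mul_of_dvd_left (dvd_pow_self 2 (by omega)) p) (ZMod 2) x = 1) S = 2) :
    IsGaoExtremal (2 ^ r * p) (U (2 ^ r * p)) S ↔
      ∃ (k : ℕ) (q : Fin k → ℕ) (b : Fin k → ℤ) (m : ℕ),
        (∀ i, (q i).Prime) ∧ 2 ^ r * p = 2 * ∏ i, q i ∧
        (∀ i, IsCoprime (b i) ((q i : ℤ))) ∧ Odd m ∧ m ≤ 2 ^ r * p ∧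
        AEquiv (U (2 ^ r * p)) S
          ((List.ofFn fun i : Fin k =>
              (((∏ j ∈ Finset.Iio i, (q j : ℤ)) * b i : ℤ) : ZMod (2 ^ r * p))) ++
            (List.replicate m ((2 ^ r * p / 2 : ℕ) : ZMod (2 ^ r * p)) ++
              List.replicate (2 ^ r * p - m) (0 : ZMod (2 ^ r * p)))) := by
  have hN4 := four_le_two_pow_mul hr hp
  rw [IsGaoExtremal, gaoC_eq hr hp hpodd, Nat.add_sub_cancel]
  constructor
  · rintro ⟨hlen, hno⟩
    obtain ⟨s, rfl⟩ : ∃ s, r = s + 2 := ⟨r - 2, by omega⟩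
    have hodd : ((S : Multiset (ZMod (2 ^ (s + 2) * p))).cnt fun x => ¬ 2 ^ (0 + 1) ∣
        (ZMod.chineseRemainder (coprime_two_pow hp hpodd (s + 2)) x).1) = 2 := by
      simp only [castHom_two_eq_one_iff hp hpodd _ (Nat.succ_ne_zero _)] at h2
      exact h2
    obtain ⟨m, hm, hmn, hrel⟩ := exists_rel_astSeq_of_two_odd hp hpodd (by simpa using hlen) hodd
      fun T hT hTc h0 => hno (hasWZSS_iff.2 ⟨by omega, T, hT, hTc, h0⟩)
    exact ⟨s + 2, chainPrimes p (s + 1), fun _ => 1, m, chainPrimes_prime hp _,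
      two_pow_mul_eq_prod_chainPrimes p _, fun _ => isCoprime_one_left, hm, hmn,
      aEquiv_iff.2 hrel⟩
  · rintro ⟨k, q, b, m, hq, hprod, hb, hm, hmn, hequiv⟩
    have hrel := aEquiv_iff.1 hequiv
    refine ⟨?_, not_hasWZSS_of_rel hrel (not_hasWZSS_astSeq (by omega) hq hprod hb hm hmn)⟩
    have hlen := length_astSeq q b hmn
    have hcard := Multiset.card_eq_card_of_rel hrel
    rw [Multiset.coe_card, Multiset.coe_card] at hcard
    have hk := eq_of_two_pow_mul_eq hp hq hprod
    exact (hcard.trans hlen).trans (by rw [hk])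
end
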